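/- Let G be a graph of treewidth at most 6 with τ(G) > 2·ν(G), chosen with the minimum number of vertices subject to these conditions. Then G is robust: for every vertex v of G, each connected component of the induced subgraph G[N(v)] has at least 5 vertices. -/

import Mathlib

open SimpleGraph

variable {V : Type*}

/-- A triangle transversal of `G`: a set of edges of `G` meeting every triangle of `G`
(so that its removal leaves a triangle-free graph). -/
def IsTriangleTransversal (G : SimpleGraph V) (X : Finset (Sym2 V)) : Prop :=
  ↑X ⊆ G.edgeSet ∧
    ∀ t : Finset V, G.IsNClique 3 t → ∃ e ∈ X, ∀ v ∈ e, v ∈ t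

/-- A triangle packing of `G`: a set of pairwise edge-disjoint triangles of `G`. -/
def IsTrianglePacking (G : SimpleGraph V) (Y : Finset (Finset V)) : Prop :=
  (∀ t ∈ Y, G.IsNClique 3 t) ∧
    ∀ s ∈ Y, ∀ t ∈ Y, s ≠ t →
      ∀ e ∈ G.edgeSet, ¬ ((∀ v ∈ e, v ∈ s) ∧ (∀ v ∈ e, v ∈ t))

/-- `tau G` is the minimum size of a triangle transversal of `G`. -/
noncomputable def tau (G : SimpleGraph V) : ℕ :=
  sInf {n | ∃ X : Finset (Sym2 V), IsTriangleTransversal G X ∧ X.card = n}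

/-- `nu G` is the maximum size of a triangle packing of `G`. -/
noncomputable def nu (G : SimpleGraph V) : ℕ :=
  sSup {n | ∃ Y : Finset (Finset V), IsTrianglePacking G Y ∧ Y.card = n}

/-- A tree decomposition of `G` with nodes indexed by `α`. -/
structure TreeDecomp (G : SimpleGraph V) (α : Type) where
  T : SimpleGraph α
  isTree : T.IsTree
  bag : α → Finset V
  covers : ∀ v : V, ∃ t : α, v ∈ bag t
  edge_mem : ∀ ⦃u w : V⦄, G.Adj u w → ∃ t : α, u ∈ bag t ∧ w ∈ bag t
  subtree : ∀ v : V, (T.induce {t : α | v ∈ bag t}).Connected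

/-- `G` has a tree decomposition of width at most `k`. -/
def HasDecompOfWidthLE (G : SimpleGraph V) (k : ℕ) : Prop :=
  ∃ (α : Type) (D : TreeDecomp G α), ∀ t : α, (D.bag t).card ≤ k + 1

/-- The treewidth of `G`. -/
noncomputable def treewidth (G : SimpleGraph V) : ℕ :=
  sInf {k | HasDecompOfWidthLE G k}

/-- A tree decomposition is full (for a graph of treewidth `k`) if every bag has exactly
`k + 1` vertices and the bags of any two adjacent nodes share exactly `k` vertices. -/
def IsFullDecomp [DecidableEq V] {G : SimpleGraph V} {α : Type}
    (D : TreeDecomp G α) (k : ℕ) : Prop :=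
  (∀ t : α, (D.bag t).card = k + 1) ∧
    ∀ t t' : α, D.T.Adj t t' → (D.bag t ∩ D.bag t').card = k

/-- `G` is robust: for every vertex `v`, each connected component of the subgraph induced
on the neighborhood of `v` has at least `5` vertices. -/
def Robust (G : SimpleGraph V) : Prop :=
  ∀ v : V, ∀ c : (G.induce (G.neighborSet v)).ConnectedComponent, 5 ≤ c.supp.ncard

namespace TriangleReduction

/-- `G` admits a reduction: deleting the edges in `S ∪ D` costs at most `|S|` in the transversal
number and at least `|P|` in the packing number, with `|S| ≤ 2 |P|`. -/
def Reducible (G : SimpleGraph V) : Prop :=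
  ∃ (P : Finset (Finset V)) (S D : Finset (Sym2 V)),
    IsTrianglePacking G P ∧ S.card ≤ 2 * P.card ∧
    (∀ t ∈ P, ∀ e ∈ G.edgeSet, (∀ v ∈ e, v ∈ t) → e ∈ S ∨ e ∈ D) ∧
    (∀ t : Finset V, G.IsNClique 3 t → (∃ e ∈ D, ∀ v ∈ e, v ∈ t) →
      ∃ e ∈ S, e ∈ G.edgeSet ∧ ∀ v ∈ e, v ∈ t) ∧
    ∃ e ∈ G.edgeSet, e ∈ S ∨ e ∈ D

/-- `G` satisfies the inequality `τ ≤ 2 ν`, in witnessed form. -/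
def TuzaBound (G : SimpleGraph V) : Prop :=
  ∃ (X : Finset (Sym2 V)) (Y : Finset (Finset V)),
    IsTriangleTransversal G X ∧ IsTrianglePacking G Y ∧ X.card ≤ 2 * Y.card

theorem TuzaBound.tau_le [Finite V] {G : SimpleGraph V} (h : TuzaBound G) :
    tau G ≤ 2 * nu G := by
  obtain ⟨X, Y, hX, hY, hXY⟩ := h
  have h₁ : tau G ≤ X.card := Nat.sInf_le ⟨X, hX, rfl⟩
  have h₂ : Y.card ≤ nu G := by
    refine le_csSup ?_ ⟨Y, hY, rfl⟩
    have : Fintype V := Fintype.ofFinite V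
    refine ⟨Fintype.card (Finset V), ?_⟩
    rintro n ⟨Z, -, rfl⟩
    exact Finset.card_le_univ Z
  omega

/-- An edge inside a triangle, as a two-element set of members of the triangle. -/
theorem exists_edge_of_isNClique {G : SimpleGraph V} {t : Finset V} (ht : G.IsNClique 3 t) :
    ∃ e ∈ G.edgeSet, ∀ v ∈ e, v ∈ t := by
  classical
  obtain ⟨a, b, c, hab, -, -, rfl⟩ := is3Clique_iff.1 ht
  refine ⟨s(a, b), hab, ?_⟩
  simp

theorem Reducible.tuzaBound {G : SimpleGraph V} (h : Reducible G)
    (ih : ∀ H : SimpleGraph V, H < G → TuzaBound H) : TuzaBound G := by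
  classical
  obtain ⟨P, S, D, hP, hSP, hPSD, hD, e₀, he₀, he₀'⟩ := h
  set H := G.deleteEdges (↑S ∪ ↑D) with hH
  have hle : H ≤ G := deleteEdges_le _
  have hlt : H < G := by
    refine lt_of_le_of_ne hle fun heq => ?_
    have : e₀ ∈ H.edgeSet := heq ▸ he₀
    rw [hH, edgeSet_deleteEdges] at this
    exact this.2 (by simpa using he₀')
  obtain ⟨X, Y, hX, hY, hXY⟩ := ih H hlt
  have hdisj : ∀ s ∈ P, ∀ t ∈ Y, ∀ e ∈ G.edgeSet, (∀ v ∈ e, v ∈ s) → ¬ ∀ v ∈ e, v ∈ t := by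
    intro s hs t ht e he hes het
    have h₁ := hPSD s hs e he hes
    have h₂ : e ∈ H.edgeSet := by
      induction e with
      | h a b =>
        have hab : a ≠ b := he.ne
        exact (hY.1 t ht).1 (het a (by simp)) (het b (by simp)) hab
    rw [hH, edgeSet_deleteEdges] at h₂
    exact h₂.2 (by simpa using h₁)
  have hYG : ∀ t ∈ Y, G.IsNClique 3 t := fun t ht => (hY.1 t ht).mono hle
  refine ⟨X ∪ S.filter (· ∈ G.edgeSet), P ∪ Y, ⟨?_, ?_⟩, ⟨?_, ?_⟩, ?_⟩
  · intro e he
    rcases Finset.mem_union.1 (Finset.mem_coe.1 he) with he | he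
    · exact edgeSet_mono hle (hX.1 he)
    · exact (Finset.mem_filter.1 he).2
  · intro t ht
    by_cases hSt : ∃ e ∈ S, e ∈ G.edgeSet ∧ ∀ v ∈ e, v ∈ t
    · obtain ⟨e, heS, heG, het⟩ := hSt
      exact ⟨e, by simp [heS, heG], het⟩
    · have hDt : ¬ ∃ e ∈ D, ∀ v ∈ e, v ∈ t := fun h' => hSt (hD t ht h')
      have htH : H.IsNClique 3 t := by
        refine ⟨fun a ha b hb hab => ?_, ht.2⟩
        have hG := ht.1 ha hb hab
        rw [hH, deleteEdges_adj]
        refine ⟨hG, ?_⟩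
        have hmem : ∀ v ∈ s(a, b), v ∈ t := by
          simpa using ⟨ha, hb⟩
        rintro (h' | h')
        · exact hSt ⟨_, h', hG, hmem⟩
        · exact hDt ⟨_, h', hmem⟩
      obtain ⟨e, he, het⟩ := hX.2 t htH
      exact ⟨e, Finset.mem_union_left _ he, het⟩
  · intro t ht
    rcases Finset.mem_union.1 ht with ht | ht
    · exact hP.1 t ht
    · exact hYG t ht
  · intro s hs t ht hst e he hh
    rcases Finset.mem_union.1 hs with hs | hs <;> rcases Finset.mem_union.1 ht with ht | ht
    · exact hP.2 s hs t ht hst e he hh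
    · exact hdisj s hs t ht e he hh.1 hh.2
    · exact hdisj t ht s hs e he hh.2 hh.1
    · refine hY.2 s hs t ht hst e ?_ hh
      induction e with
      | h a b =>
        exact (hY.1 t ht).1 (hh.2 a (by simp)) (hh.2 b (by simp)) he.ne
  · have hPY : Disjoint P Y := by
      rw [Finset.disjoint_left]
      intro t htP htY
      obtain ⟨e, he, het⟩ := exists_edge_of_isNClique (hP.1 t htP)
      exact hdisj t htP t htY e he het het
    have h₁ := Finset.card_union_le X (S.filter (· ∈ G.edgeSet))
    have h₂ := Finset.card_filter_le S (· ∈ G.edgeSet)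
    rw [Finset.card_union_of_disjoint hPY]
    omega

/-! ### Certificates for reductions

Local vertices are numbered by digits, `10 * i + j` with `i < j` encodes a pair and
`100 * i + 10 * j + k` with `i < j < k` a triple. -/

/-- The code of the pair `{i, j}`. -/
def pairCode (i j : ℕ) : ℕ := if i < j then 10 * i + j else 10 * j + i

/-- The codes of the three pairs in a triple. -/
def tripleEdges (t : ℕ) : List ℕ := [t / 10, t / 100 * 10 + t % 10, t % 100]

/-- A decision tree over adjacencies of local vertices whose leaves are reductions
(a packing, additional transversal edges, and edges to be deleted) or violations of
the condition `AtMostOneGap`. -/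
inductive Plan
  | cert (P X D : List ℕ)
  | split (e : ℕ) (p q : Plan)
  | gaps (c e e' : ℕ)

/-- The transversal edges of a certificate. -/
def certEdges (P X D : List ℕ) : List ℕ :=
  (P.flatMap tripleEdges).filter (fun e => !D.contains e) ++ X

/-- Validity of a plan, given local adjacencies `yes` and non-adjacencies `no`, local vertices
`closed` all of whose neighbours are local, and local vertices `five` with at most one gap. -/
def Plan.check (n : ℕ) (closed five : List ℕ) : List ℕ → List ℕ → Plan → Bool
  | yes, no, .cert P X D =>
    let S := certEdges P X D
    decide (n ≤ 10) && decide (S.length ≤ 2 * P.length) && decide (P.flatMap tripleEdges).Nodup &&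
    P.all (fun t => decide (t / 100 < t / 10 % 10 ∧ t / 10 % 10 < t % 10 ∧ t % 10 < n)) &&
    (P.flatMap tripleEdges).all (fun e => yes.contains e) &&
    D.all (fun d => decide (d / 10 < d % 10 ∧ d % 10 < n) &&
      (closed.contains (d / 10) || closed.contains (d % 10)) &&
      (no.contains d || S.contains d || (List.range n).all fun k =>
        k == d / 10 || k == d % 10 ||
        no.contains (pairCode (d / 10) k) || S.contains (pairCode (d / 10) k) ||
        no.contains (pairCode (d % 10) k) || S.contains (pairCode (d % 10) k))) &&
    (P.flatMap tripleEdges ++ D).any (fun e => yes.contains e)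
  | yes, no, .split e p q =>
    p.check n closed five (e :: yes) no && q.check n closed five yes (e :: no)
  | yes, no, .gaps c e e' =>
    five.contains c && no.contains e && no.contains e' && decide (n ≤ 10 ∧ e ≠ e' ∧ c < n ∧
      e / 10 < e % 10 ∧ e % 10 < n ∧ e' / 10 < e' % 10 ∧ e' % 10 < n) &&
    yes.contains (pairCode c (e / 10)) && yes.contains (pairCode c (e % 10)) &&
    yes.contains (pairCode c (e' / 10)) && yes.contains (pairCode c (e' % 10))

/-- At most one pair of neighbours of `c` is non-adjacent. -/
def AtMostOneGap (G : SimpleGraph V) (c : V) : Prop :=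
  ∀ a b a' b', G.Adj c a → G.Adj c b → G.Adj c a' → G.Adj c b' → a ≠ b → a' ≠ b' →
    ¬ G.Adj a b → ¬ G.Adj a' b' → s(a, b) = s(a', b')

theorem adj_pairCode {G : SimpleGraph V} {f : ℕ → V} {i j : ℕ} (hi : i < 10) (hj : j < 10) :
    G.Adj (f (pairCode i j / 10)) (f (pairCode i j % 10)) ↔ G.Adj (f i) (f j) := by
  unfold pairCode
  split_ifs
  · rw [show (10 * i + j) / 10 = i by omega, show (10 * i + j) % 10 = j by omega]
  · rw [show (10 * j + i) / 10 = j by omega, show (10 * j + i) % 10 = i by omega, G.adj_comm]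

theorem sym2_pairCode {f : ℕ → V} {i j : ℕ} (hi : i < 10) (hj : j < 10) :
    s(f (pairCode i j / 10), f (pairCode i j % 10)) = s(f i, f j) := by
  unfold pairCode
  split_ifs
  · rw [show (10 * i + j) / 10 = i by omega, show (10 * i + j) % 10 = j by omega]
  · rw [show (10 * j + i) / 10 = j by omega, show (10 * j + i) % 10 = i by omega, Sym2.eq_swap]

theorem pairCode_mem_tripleEdges {t a b : ℕ}
    (ht : t / 100 < t / 10 % 10 ∧ t / 10 % 10 < t % 10)
    (ha : a = t / 100 ∨ a = t / 10 % 10 ∨ a = t % 10)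
    (hb : b = t / 100 ∨ b = t / 10 % 10 ∨ b = t % 10) (hab : a ≠ b) :
    pairCode a b ∈ tripleEdges t := by
  simp only [tripleEdges, List.mem_cons, List.not_mem_nil, or_false, pairCode]
  split_ifs <;> omega

theorem reducible_of_cert {G : SimpleGraph V} {f : ℕ → V} {n : ℕ} {closed five yes no : List ℕ}
    {P X D : List ℕ} (hf : ∀ i < n, ∀ j < n, f i = f j → i = j)
    (hclosed : ∀ c ∈ closed, ∀ w, G.Adj (f c) w → ∃ k < n, f k = w)
    (hyes : ∀ e ∈ yes, G.Adj (f (e / 10)) (f (e % 10)))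
    (hno : ∀ e ∈ no, ¬ G.Adj (f (e / 10)) (f (e % 10)))
    (h : Plan.check n closed five yes no (.cert P X D) = true) : Reducible G := by
  classical
  simp only [Plan.check, Bool.and_eq_true, decide_eq_true_eq, List.all_eq_true, List.any_eq_true,
    Bool.or_eq_true, beq_iff_eq, List.contains_iff_mem, List.mem_range] at h
  obtain ⟨⟨⟨⟨⟨⟨hn, hSP⟩, hnodup⟩, hPwf⟩, hPyes⟩, hD⟩, e₀, he₀, he₀y⟩ := h
  set S := certEdges P X D with hS
  have hES : ∀ e ∈ P.flatMap tripleEdges, e ∈ S ∨ e ∈ D := by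
    intro e he
    by_cases heD : e ∈ D
    · exact Or.inr heD
    · left
      rw [hS, certEdges, List.mem_append, List.mem_filter]
      exact Or.inl ⟨he, by simpa using heD⟩
  let tri : ℕ → Finset V := fun t => {f (t / 100), f (t / 10 % 10), f (t % 10)}
  let edge : ℕ → Sym2 V := fun e => s(f (e / 10), f (e % 10))
  have htri : ∀ t ∈ P, G.IsNClique 3 (tri t) := by
    intro t ht
    have h₁ := hPwf t ht
    have h₂ : ∀ e ∈ tripleEdges t, G.Adj (f (e / 10)) (f (e % 10)) := fun e he =>
      hyes e (hPyes e (List.mem_flatMap.2 ⟨t, ht, he⟩))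
    refine is3Clique_iff.2 ⟨_, _, _, ?_, ?_, ?_, rfl⟩
    · exact (adj_pairCode (by omega) (by omega)).1
        (h₂ _ (pairCode_mem_tripleEdges ⟨h₁.1, h₁.2.1⟩ (by simp) (by simp) (by omega)))
    · exact (adj_pairCode (by omega) (by omega)).1
        (h₂ _ (pairCode_mem_tripleEdges ⟨h₁.1, h₁.2.1⟩ (by simp) (by simp) (by omega)))
    · exact (adj_pairCode (by omega) (by omega)).1
        (h₂ _ (pairCode_mem_tripleEdges ⟨h₁.1, h₁.2.1⟩ (by simp) (by simp) (by omega)))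
  have hmem : ∀ t ∈ P, ∀ x ∈ tri t, ∃ i < n, f i = x ∧
      (i = t / 100 ∨ i = t / 10 % 10 ∨ i = t % 10) := by
    intro t ht x hx
    have h₁ := hPwf t ht
    simp only [tri, Finset.mem_insert, Finset.mem_singleton] at hx
    rcases hx with rfl | rfl | rfl
    · exact ⟨_, by omega, rfl, by simp⟩
    · exact ⟨_, by omega, rfl, by simp⟩
    · exact ⟨_, by omega, rfl, by simp⟩
  have hcode : ∀ t ∈ P, ∀ i < n, ∀ j < n, i ≠ j → f i ∈ tri t → f j ∈ tri t →
      pairCode i j ∈ tripleEdges t := by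
    intro t ht i hi j hj hij hit hjt
    obtain ⟨i', hi', hii, hi''⟩ := hmem t ht _ hit
    obtain ⟨j', hj', hjj, hj''⟩ := hmem t ht _ hjt
    obtain rfl := hf _ hi' _ hi hii
    obtain rfl := hf _ hj' _ hj hjj
    have h₁ := hPwf t ht
    exact pairCode_mem_tripleEdges ⟨h₁.1, h₁.2.1⟩ hi'' hj'' hij
  have hdisj : P.Pairwise (fun s t => List.Disjoint (tripleEdges s) (tripleEdges t)) :=
    (List.nodup_flatMap.1 hnodup).2
  have hdisj' : ∀ s ∈ P, ∀ t ∈ P, s ≠ t → List.Disjoint (tripleEdges s) (tripleEdges t) := by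
    intro s hs t ht hst
    have : Std.Symm (fun s t => List.Disjoint (tripleEdges s) (tripleEdges t)) :=
      ⟨fun _ _ h => h.symm⟩
    exact hdisj.forall hs ht hst
  have hshare : ∀ s ∈ P, ∀ t ∈ P, ∀ x y, x ≠ y → x ∈ tri s → y ∈ tri s → x ∈ tri t →
      y ∈ tri t → s = t := by
    intro s hs t ht x y hxy hxs hys hxt hyt
    by_contra hst
    obtain ⟨i, hi, rfl, -⟩ := hmem s hs _ hxs
    obtain ⟨j, hj, rfl, -⟩ := hmem s hs _ hys
    have hij : i ≠ j := fun h => hxy (h ▸ rfl)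
    exact hdisj' s hs t ht hst (hcode s hs i hi j hj hij hxs hys) (hcode t ht i hi j hj hij hxt hyt)
  have hPnodup : P.Nodup := by
    refine hdisj.imp fun {s t} h => ?_
    rintro rfl
    exact h (a := s / 10) (by simp [tripleEdges]) (by simp [tripleEdges])
  have hcard : (P.map tri).toFinset.card = P.length := by
    rw [List.toFinset_card_of_nodup, List.length_map]
    refine List.Nodup.map_on (fun s hs t ht hst => ?_) hPnodup
    have h₁ := hPwf s hs
    refine hshare s hs t ht (f (s / 100)) (f (s % 10)) ?_ ?_ ?_ ?_ ?_
    · intro h'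
      have := hf _ (by omega) _ (by omega) h'
      omega
    · simp [tri]
    · simp [tri]
    · rw [← hst]; simp [tri]
    · rw [← hst]; simp [tri]
  refine ⟨(P.map tri).toFinset, (S.map edge).toFinset, (D.map edge).toFinset,
    ⟨?_, ?_⟩, ?_, ?_, ?_, ?_⟩
  · intro t ht
    simp only [List.mem_toFinset, List.mem_map] at ht
    obtain ⟨t, ht, rfl⟩ := ht
    exact htri t ht
  · intro s hs t ht hst e he hh
    simp only [List.mem_toFinset, List.mem_map] at hs ht
    obtain ⟨s, hs, rfl⟩ := hs
    obtain ⟨t, ht, rfl⟩ := ht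
    induction e with
    | h x y =>
      refine hst (congrArg tri (hshare s hs t ht x y he.ne ?_ ?_ ?_ ?_))
      · exact hh.1 x (by simp)
      · exact hh.1 y (by simp)
      · exact hh.2 x (by simp)
      · exact hh.2 y (by simp)
  · rw [hcard]
    refine (List.toFinset_card_le _).trans ?_
    rwa [List.length_map]
  · intro t ht e he hh
    simp only [List.mem_toFinset, List.mem_map] at ht ⊢
    obtain ⟨t, ht, rfl⟩ := ht
    induction e with
    | h x y =>
      have hx := hh x (by simp)
      have hy := hh y (by simp)
      obtain ⟨i, hi, rfl, -⟩ := hmem t ht _ hx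
      obtain ⟨j, hj, rfl, -⟩ := hmem t ht _ hy
      have hij : i ≠ j := fun h => he.ne (h ▸ rfl)
      have h₁ := hES _ (List.mem_flatMap.2 ⟨t, ht, hcode t ht i hi j hj hij hx hy⟩)
      have h₂ : edge (pairCode i j) = s(f i, f j) := sym2_pairCode (by omega) (by omega)
      exact h₁.imp (fun h => ⟨_, h, h₂⟩) (fun h => ⟨_, h, h₂⟩)
  · rintro t ht ⟨e, he, het⟩
    simp only [List.mem_toFinset, List.mem_map] at he
    obtain ⟨d, hd, rfl⟩ := he
    obtain ⟨⟨hdwf, hdc⟩, hk⟩ := hD d hd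
    have hx : f (d / 10) ∈ t := het _ (by simp [edge])
    have hy : f (d % 10) ∈ t := het _ (by simp [edge])
    have hxy : f (d / 10) ≠ f (d % 10) := fun h' => by
      have := hf _ (by omega) _ hdwf.2 h'
      omega
    have hadj : G.Adj (f (d / 10)) (f (d % 10)) := ht.1 hx hy hxy
    have use : ∀ c ∈ S, ∀ i < n, ∀ j < n, edge c = s(f i, f j) → f i ∈ t → f j ∈ t →
        i ≠ j → ∃ e ∈ (S.map edge).toFinset, e ∈ G.edgeSet ∧ ∀ v ∈ e, v ∈ t := by
      intro c hc i hi j hj hcij hit hjt hij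
      refine ⟨edge c, by simpa using ⟨c, hc, rfl⟩, ?_⟩
      rw [hcij]
      refine ⟨ht.1 hit hjt (fun h' => hij (hf _ hi _ hj h')), ?_⟩
      simpa using ⟨hit, hjt⟩
    rcases hk with (hk | hk) | hk
    · exact absurd hadj (hno d hk)
    · exact use d hk _ (by omega) _ hdwf.2 rfl hx hy (by omega)
    · obtain ⟨z, hz, hzx, hzy⟩ : ∃ z ∈ t, z ≠ f (d / 10) ∧ z ≠ f (d % 10) := by
        by_contra! hcon
        have : t ⊆ {f (d / 10), f (d % 10)} := by
          intro z hz
          by_cases h' : z = f (d / 10)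
          · simp [h']
          · simp [hcon z hz h']
        have := (Finset.card_le_card this).trans Finset.card_le_two
        rw [ht.2] at this
        omega
      have hxz : G.Adj (f (d / 10)) z := ht.1 hx hz hzx.symm
      have hyz : G.Adj (f (d % 10)) z := ht.1 hy hz hzy.symm
      obtain ⟨k, hkn, rfl⟩ : ∃ k < n, f k = z := by
        rcases hdc with h' | h'
        · exact hclosed _ h' _ hxz
        · exact hclosed _ h' _ hyz
      have hk₁ : d / 10 ≠ k := fun h' => hzx (by rw [h'])
      have hk₂ : d % 10 ≠ k := fun h' => hzy (by rw [h'])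
      rcases hk k hkn with ((((h' | h') | h') | h') | h') | h'
      · exact absurd h'.symm hk₁
      · exact absurd h'.symm hk₂
      · exact absurd ((adj_pairCode (by omega) (by omega)).2 hxz) (hno _ h')
      · exact use _ h' _ (by omega) _ hkn (sym2_pairCode (by omega) (by omega)) hx hz hk₁
      · exact absurd ((adj_pairCode (by omega) (by omega)).2 hyz) (hno _ h')
      · exact use _ h' _ hdwf.2 _ hkn (sym2_pairCode (by omega) (by omega)) hy hz hk₂
  · refine ⟨edge e₀, hyes _ he₀y, ?_⟩
    have h₁ : e₀ ∈ S ∨ e₀ ∈ D := by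
      rcases List.mem_append.1 he₀ with h' | h'
      · exact hES _ h'
      · exact Or.inr h'
    simp only [List.mem_toFinset, List.mem_map]
    exact h₁.imp (fun h => ⟨_, h, rfl⟩) (fun h => ⟨_, h, rfl⟩)

theorem Plan.reducible_of_check {G : SimpleGraph V} {f : ℕ → V} {n : ℕ} {closed five : List ℕ}
    (hf : ∀ i < n, ∀ j < n, f i = f j → i = j)
    (hclosed : ∀ c ∈ closed, ∀ w, G.Adj (f c) w → ∃ k < n, f k = w)
    (hfive : ∀ c ∈ five, AtMostOneGap G (f c)) (p : Plan) :
    ∀ {yes no : List ℕ}, (∀ e ∈ yes, G.Adj (f (e / 10)) (f (e % 10))) →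
      (∀ e ∈ no, ¬ G.Adj (f (e / 10)) (f (e % 10))) →
      p.check n closed five yes no = true → Reducible G := by
  induction p with
  | cert P X D => exact fun hyes hno h => reducible_of_cert hf hclosed hyes hno h
  | split e p q ihp ihq =>
    intro yes no hyes hno h
    simp only [Plan.check, Bool.and_eq_true] at h
    by_cases he : G.Adj (f (e / 10)) (f (e % 10))
    · exact ihp (List.forall_mem_cons.2 ⟨he, hyes⟩) hno h.1
    · exact ihq hyes (List.forall_mem_cons.2 ⟨he, hno⟩) h.2
  | gaps c e e' =>
    intro yes no hyes hno h
    simp only [Plan.check, Bool.and_eq_true, decide_eq_true_eq, List.contains_iff_mem] at h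
    obtain ⟨⟨⟨⟨⟨⟨⟨hc, he⟩, he'⟩, hn, hne, hcn, h₁, h₂, h₃, h₄⟩, h₅⟩, h₆⟩, h₇⟩, h₈⟩ := h
    have key := hfive c hc (f (e / 10)) (f (e % 10)) (f (e' / 10)) (f (e' % 10))
      ((adj_pairCode (by omega) (by omega)).1 (hyes _ h₅))
      ((adj_pairCode (by omega) (by omega)).1 (hyes _ h₆))
      ((adj_pairCode (by omega) (by omega)).1 (hyes _ h₇))
      ((adj_pairCode (by omega) (by omega)).1 (hyes _ h₈))
      (fun h' => by have := hf _ (by omega) _ h₂ h'; omega)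
      (fun h' => by have := hf _ (by omega) _ h₄ h'; omega) (hno _ he) (hno _ he')
    rw [Sym2.eq_iff] at key
    exfalso
    rcases key with ⟨k₁, k₂⟩ | ⟨k₁, k₂⟩
    · have := hf _ (by omega) _ (by omega) k₁
      have := hf _ (by omega) _ (by omega) k₂
      omega
    · have := hf _ (by omega) _ (by omega) k₁
      have := hf _ (by omega) _ (by omega) k₂
      omega

/-- A valid plan for a list of distinct vertices yields a reduction. -/
theorem Plan.reducible (p : Plan) {G : SimpleGraph V} (v : V) (l : List V)
    (closed five yes no : List ℕ) (hl : (v :: l).Nodup)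
    (hclosed : ∀ c ∈ closed, ∀ w, G.Adj ((v :: l).getD c v) w → w ∈ v :: l)
    (hfive : ∀ c ∈ five, AtMostOneGap G ((v :: l).getD c v))
    (hyes : ∀ e ∈ yes, G.Adj ((v :: l).getD (e / 10) v) ((v :: l).getD (e % 10) v))
    (hno : ∀ e ∈ no, ¬ G.Adj ((v :: l).getD (e / 10) v) ((v :: l).getD (e % 10) v))
    (h : p.check (v :: l).length closed five yes no = true) : Reducible G := by
  refine p.reducible_of_check (f := fun i => (v :: l).getD i v) (n := (v :: l).length)
    (fun i hi j hj hij => ?_) (fun c hc w hw => ?_) hfive hyes hno h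
  · simp only [List.getD_eq_getElem _ _ hi, List.getD_eq_getElem _ _ hj] at hij
    exact (List.Nodup.getElem_inj_iff hl).1 hij
  · obtain ⟨k, hk, hkw⟩ := List.getElem_of_mem (hclosed c hc w hw)
    exact ⟨k, hk, by simpa only [List.getD_eq_getElem _ _ hk] using hkw⟩

/-! ### Plans for the local configurations -/

def Plan.degreeOne : Plan :=
  .cert [] [] [1]

def Plan.degreeTwo : Plan :=
  .split 12 (.cert [12] [] [2]) (.cert [] [] [2])

def Plan.degreeThree : Plan :=
  .split 12 (.cert [12] [3] [1, 2]) (.split 13 (.cert [13] [2] [1, 3]) (.cert [] [] [1]))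

def Plan.degreeFour : Plan :=
  .split 12 (.split 34 (.cert [12, 34] [] [3, 4]) (.split 13 (.split 14 (.split 23 (.cert [14,
  23] [] [3, 4]) (.cert [13] [] [3])) (.cert [13] [2] [1, 3])) (.split 14 (.cert [14] [2] [1, 4])
  (.cert [12] [] [1])))) (.split 13 (.split 14 (.split 23 (.cert [14, 23] [] [1, 4]) (.cert [13]
  [4] [1, 3])) (.cert [13] [] [1])) (.split 14 (.cert [14] [] [1]) (.cert [] [] [1])))

def Plan.degreeFiveCherry : Plan :=
  .split 14 (.split 15 (.split 23 (.cert [14, 23] [5] [1, 2, 3]) (.split 24 (.cert [15, 24] []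
  [1, 2]) (.split 25 (.cert [14, 25] [3] [1, 2, 4]) (.cert [] [] [2])))) (.cert [14] [] [1]))
  (.split 15 (.cert [15] [] [1]) (.cert [] [] [1]))

def Plan.degreeFiveGaps : Plan :=
  .cert [13, 24, 145, 235] [] [1, 2, 3, 4]

def Plan.degreeSixCherry : Plan :=
  .split 14 (.split 15 (.split 16 (.split 23 (.split 45 (.cert [16, 23, 45] [] [1, 2, 3]) (.split
  46 (.cert [15, 23, 46] [] [1, 2, 3]) (.split 56 (.cert [14, 23, 56] [] [4, 5, 6]) (.split 24
  (.split 35 (.cert [16, 24, 35] [] [4, 5, 6]) (.split 25 (.split 34 (.cert [16, 25, 34] [] [4,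
  5, 6]) (.cert [14, 25] [] [4, 5])) (.cert [15, 23] [4, 6] [1, 2, 3, 5]))) (.split 34 (.split 25
  (.cert [16, 25, 34] [] [4, 5, 6]) (.cert [15, 34] [] [4, 5])) (.cert [14, 23] [5, 6] [1, 2, 3,
  4])))))) (.split 24 (.split 35 (.cert [16, 24, 35] [] [1, 2, 3]) (.split 25 (.split 34 (.cert
  [16, 25, 34] [] [2, 3, 5]) (.split 36 (.cert [14, 25, 36] [24] [1, 2, 3, 4]) (.cert [] []
  [3]))) (.cert [15, 24] [6] [1, 2, 5]))) (.split 25 (.split 34 (.cert [16, 25, 34] [] [1, 2, 3])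
  (.cert [14, 25] [6] [1, 2, 4])) (.split 26 (.cert [26] [] [2]) (.cert [] [] [2]))))) (.split 23
  (.split 46 (.cert [15, 23, 46] [] [1, 2, 3]) (.split 56 (.cert [14, 23, 56] [] [1, 4, 6])
  (.split 24 (.split 35 (.split 26 (.cert [14, 26, 35] [] [1, 4, 6]) (.split 25 (.cert [15, 24,
  235] [] [1, 2, 5]) (.cert [15, 24] [3] [1, 2, 5]))) (.cert [15, 24] [] [1, 5])) (.split 26
  (.cert [14, 26] [3, 5] [1, 2, 4, 6]) (.cert [14, 23] [5] [1, 2, 4]))))) (.split 24 (.split 26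
  (.split 36 (.cert [15, 24, 36] [] [1, 3, 6]) (.cert [14, 26] [5] [1, 2, 6])) (.cert [15, 24] []
  [1, 2])) (.split 25 (.split 26 (.split 34 (.cert [15, 26, 34] [] [1, 2, 6]) (.cert [14, 25] [6]
  [1, 2, 4])) (.cert [14, 25] [] [1, 2])) (.split 26 (.cert [26] [] [2]) (.cert [] [] [2]))))))
  (.split 16 (.split 23 (.split 45 (.cert [16, 23, 45] [] [1, 2, 3]) (.split 56 (.cert [14, 23,
  56] [] [1, 4, 5]) (.split 24 (.split 36 (.split 25 (.cert [14, 25, 36] [] [1, 4, 5]) (.split 26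
  (.cert [16, 24, 236] [] [1, 2, 6]) (.cert [16, 24] [3] [1, 2, 6]))) (.cert [16, 24] [] [1, 6]))
  (.split 25 (.cert [14, 25] [3, 6] [1, 2, 4, 5]) (.cert [14, 23] [6] [1, 2, 4]))))) (.split 24
  (.split 25 (.split 35 (.cert [16, 24, 35] [] [1, 3, 5]) (.cert [14, 25] [6] [1, 2, 5])) (.cert
  [16, 24] [] [1, 2])) (.split 25 (.split 34 (.cert [16, 25, 34] [] [1, 2, 5]) (.cert [14, 25]
  [6] [1, 2, 4])) (.split 26 (.cert [14, 26] [] [1, 2]) (.cert [] [] [2]))))) (.cert [14] []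
  [1]))) (.split 15 (.split 16 (.split 23 (.split 45 (.cert [16, 23, 45] [] [1, 2, 3]) (.split 46
  (.cert [15, 23, 46] [] [1, 2, 3]) (.split 24 (.split 25 (.split 34 (.cert [16, 25, 34] [] [1,
  4, 6]) (.cert [24] [] [4])) (.cert [15, 24] [3, 6] [1, 2, 4, 5])) (.split 34 (.cert [34] []
  [4]) (.cert [] [] [4]))))) (.split 24 (.split 34 (.split 25 (.cert [16, 25, 34] [] [1, 2, 3])
  (.split 26 (.cert [15, 26, 34] [] [1, 3, 4]) (.cert [24] [] [2]))) (.cert [15, 24] [6] [1, 2,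
  4])) (.split 25 (.cert [16, 25] [] [1, 2]) (.split 26 (.cert [15, 26] [] [1, 2]) (.cert [] []
  [2]))))) (.cert [15] [] [1])) (.split 16 (.cert [16] [] [1]) (.cert [] [] [1])))

def Plan.sixSix : Plan :=
  .cert [26, 35, 47, 124, 137, 156, 257] [45, 46, 67] [2, 4, 5, 6, 7, 12, 14, 15, 16, 17]

def Plan.sixFive : Plan :=
  .cert [26, 34, 57, 135, 147] [16, 37, 45] [3, 4, 5, 7, 13, 14, 15, 17]

def Plan.sixSixShift : Plan :=
  .split 45 (.split 23 (.cert [26, 34, 57, 135, 147, 237, 245] [16, 18] [2, 3, 4, 5, 7, 13, 14,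
  15, 17]) (.cert [25, 36, 47, 137, 156, 246, 345] [18] [2, 3, 4, 5, 6, 13, 15, 16])) (.cert [27,
  35, 46, 136, 157, 347] [18, 56, 67] [3, 4, 5, 6, 7, 13, 15, 16, 17])

def Plan.sixFiveFourA : Plan :=
  .split 45 (.split 67 (.cert [45, 67, 146, 157, 347, 356] [2, 18] [4, 5, 6, 7, 14, 15, 16, 17])
  (.cert [26, 34, 57, 147, 156, 245] [18, 46] [4, 5, 6, 7, 14, 15, 16, 17])) (.cert [25, 36, 47,
  146, 157] [18] [4, 5, 7, 14, 15, 17])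

def Plan.sixFiveFourB : Plan :=
  .cert [24, 36, 57, 137, 156] [18, 35, 67] [3, 5, 6, 7, 13, 15, 16, 17]

def Plan.fiveFive : Plan :=
  .cert [26, 34, 125, 146, 356] [23, 24, 45] [2, 3, 4, 6, 12, 14, 15, 16]

def Plan.fiveFiveFourA : Plan :=
  .cert [35, 46, 136, 145] [2, 17, 34, 56] [3, 4, 5, 6, 13, 14, 15, 16]

def Plan.fiveFiveFourB : Plan :=
  .cert [25, 36, 126, 135, 456] [4, 17, 23] [2, 3, 5, 6, 12, 13, 15, 16]

def Plan.leafSixNone : Plan :=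
  .split 12 (.cert [16, 23, 45, 124, 135] [25, 34] [2, 3, 4, 5, 12, 13, 14, 15]) (.cert [14, 26,
  35, 136] [] [1, 2, 6, 13])

def Plan.leafSixOne : Plan :=
  .split 12 (.cert [16, 24, 35, 123, 145] [17, 25, 34] [2, 3, 4, 5, 12, 13, 14, 15]) (.split 34
  (.cert [16, 24, 35, 145, 346] [17, 56] [3, 4, 5, 6, 14, 15, 16]) (.cert [35, 46, 136, 145] [1,
  2, 17, 56] [3, 4, 5, 6, 13, 14, 15, 16]))

def Plan.leafFiveNoneA : Plan :=
  .cert [14, 25, 135, 234] [] [2, 5, 13, 15]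

def Plan.leafFiveOneA : Plan :=
  .cert [14, 23, 135, 245] [16, 34] [2, 3, 4, 13, 14, 15]

def Plan.leafFiveTwoA : Plan :=
  .split 67 (.cert [13, 25, 145, 167, 234] [35] [2, 3, 5, 13, 14, 15]) (.split 12 (.split 26
  (.cert [15, 24, 126, 134, 235] [17, 45] [2, 4, 5, 12, 13, 14, 15]) (.split 27 (.cert [13, 24,
  127, 145, 235] [16, 34] [2, 3, 4, 12, 13, 14, 15]) (.split 36 (.cert [14, 23, 125, 136, 345] []
  [1, 3, 4, 12, 16]) (.split 37 (.cert [12, 137, 145] [] [1, 12, 17]) (.cert [14, 25, 123, 345]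
  [] [4, 5, 12, 13]))))) (.split 26 (.split 27 (.split 36 (.split 37 (.split 46 (.cert [15, 34,
  137, 146, 245] [] [1, 4, 5, 13, 17]) (.cert [25, 34, 136, 145] [17] [2, 5, 13, 14, 16])) (.cert
  [25, 34, 136, 145] [24] [2, 4, 5, 13, 16])) (.split 37 (.cert [15, 24, 137] [3, 14] [1, 2, 4,
  13, 17]) (.cert [14, 23, 135, 245] [] [1, 2, 4, 13]))) (.split 36 (.split 37 (.split 46 (.cert
  [15, 24, 137, 146, 235] [] [1, 2, 5, 16, 17]) (.cert [15, 34, 136, 235] [] [1, 3, 5, 16]))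
  (.cert [15, 24, 136] [3, 14] [1, 2, 4, 13, 16])) (.split 37 (.cert [14, 35, 137, 245] [15] [1,
  4, 5, 13, 17]) (.cert [13, 25, 145] [24] [1, 2, 5, 13])))) (.split 27 (.split 36 (.split 37
  (.split 46 (.cert [15, 34, 137, 146, 235] [] [1, 3, 5, 14, 16]) (.cert [15, 34, 136, 235] []
  [1, 3, 5, 16])) (.cert [15, 23, 136, 245] [14] [1, 2, 5, 13, 16])) (.split 37 (.cert [24, 35,
  137, 145] [] [2, 4, 13, 17]) (.cert [13, 25, 145] [24] [1, 2, 5, 13]))) (.split 36 (.split 37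
  (.split 46 (.cert [15, 34, 137, 146, 245] [] [1, 4, 5, 16, 17]) (.cert [15, 23, 136] [4] [1, 2,
  3, 16])) (.cert [14, 25, 136] [3, 15] [1, 2, 5, 13, 16])) (.split 37 (.cert [14, 35, 137, 245]
  [15] [1, 4, 5, 13, 17]) (.cert [15, 23, 134, 245] [] [1, 2, 5, 13]))))))

def Plan.leafFiveNoneB : Plan :=
  .cert [13, 24, 125, 345] [] [2, 4, 13, 15]

def Plan.leafFiveOneB : Plan :=
  .cert [12, 34, 135, 245] [16, 23] [2, 3, 4, 12, 13, 15]

def Plan.leafFiveTwoB : Plan :=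
  .split 23 (.split 26 (.cert [13, 24, 126, 145, 235] [17, 34] [2, 3, 4, 12, 13, 14, 15]) (.split
  27 (.cert [13, 24, 127, 145, 235] [16, 34] [2, 3, 4, 12, 13, 14, 15]) (.split 36 (.cert [12,
  35, 136, 145, 234] [17, 25] [2, 3, 5, 12, 13, 14, 15]) (.split 37 (.cert [15, 34, 124, 137,
  235] [16, 45] [3, 4, 5, 12, 13, 14, 15]) (.cert [14, 35, 123] [25] [3, 5, 12, 13]))))) (.cert
  [12, 35, 134, 245] [16, 17] [2, 3, 5, 12, 13, 14])

def Plan.threeGapA : Plan :=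
  .split 24 (.split 27 (.split 34 (.cert [25, 36, 127, 134, 246] [18] [2, 3, 6, 12, 13, 14])
  (.gaps 0 23 34)) (.gaps 1 23 27)) (.gaps 0 23 24)

def Plan.threeGapB : Plan :=
  .split 23 (.split 24 (.split 34 (.split 27 (.cert [23, 45, 127, 134, 246, 356] [18] [2, 3, 4,
  5, 12, 13, 14]) (.split 28 (.cert [24, 35, 128, 134, 236, 456] [17] [2, 3, 4, 5, 12, 13, 14])
  (.gaps 1 27 28))) (.gaps 0 25 34)) (.gaps 0 24 25)) (.gaps 0 23 25)

def Plan.threeGapC : Plan :=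
  .split 23 (.split 24 (.split 34 (.split 27 (.cert [36, 45, 127, 134, 235, 246] [18] [3, 4, 5,
  6, 12, 13, 14]) (.split 28 (.cert [36, 45, 128, 134, 235, 246] [17] [3, 4, 5, 6, 12, 13, 14])
  (.gaps 1 27 28))) (.gaps 0 34 56)) (.gaps 0 24 56)) (.gaps 0 23 56)

def Plan.threeClosed : Plan :=
  .cert [26, 34, 128, 237, 245, 356] [46] [3, 4, 6, 23, 24, 25, 26]

def Plan.threeLeaves : Plan :=
  .cert [23, 138, 147, 248, 256, 279, 345, 367, 578, 689] [] [2, 3, 13, 14, 17, 18, 29, 69, 79,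
  89]

/-- All pairs among six vertices are adjacent, except possibly `a b`, `c d` and `e g`. -/
def Cocktail (G : SimpleGraph V) (a b c d e g : V) : Prop :=
  (G.Adj a c ∧ G.Adj a d ∧ G.Adj a e ∧ G.Adj a g ∧ G.Adj b c ∧ G.Adj b d ∧ G.Adj b e ∧ G.Adj b g) ∧
  G.Adj c e ∧ G.Adj c g ∧ G.Adj d e ∧ G.Adj d g

/-- All pairs among five vertices are adjacent, except possibly `a b`. -/
def NearClique (G : SimpleGraph V) (a b c d e : V) : Prop :=
  (G.Adj a c ∧ G.Adj a d ∧ G.Adj a e ∧ G.Adj b c ∧ G.Adj b d ∧ G.Adj b e) ∧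
  G.Adj c d ∧ G.Adj c e ∧ G.Adj d e

/-! ### Reducible configurations -/

section Configurations

variable {G : SimpleGraph V}

theorem reducible_of_degree_one {v a : V} (hl : [v, a].Nodup)
    (hN : ∀ w, G.Adj v w ↔ w ∈ [a]) : Reducible G := by
  refine Plan.degreeOne.reducible v [a] [0] [] [1] [] hl
    ?_ ?_ ?_ ?_ (show Plan.check 2 _ _ _ _ _ = true by decide +kernel) <;> simp [*]

theorem reducible_of_degree_two {v a b : V} (hl : [v, a, b].Nodup)
    (hN : ∀ w, G.Adj v w ↔ w ∈ [a, b]) : Reducible G := by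
  refine Plan.degreeTwo.reducible v [a, b] [0] [] [1, 2] [] hl
    ?_ ?_ ?_ ?_ (show Plan.check 3 _ _ _ _ _ = true by decide +kernel) <;> simp [*]

theorem reducible_of_degree_three {v a b c : V} (hl : [v, a, b, c].Nodup)
    (hN : ∀ w, G.Adj v w ↔ w ∈ [a, b, c]) : Reducible G := by
  refine Plan.degreeThree.reducible v [a, b, c] [0] [] [1, 2, 3] [] hl
    ?_ ?_ ?_ ?_ (show Plan.check 4 _ _ _ _ _ = true by decide +kernel) <;> simp [*]

theorem reducible_of_degree_four {v a b c d : V} (hl : [v, a, b, c, d].Nodup)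
    (hN : ∀ w, G.Adj v w ↔ w ∈ [a, b, c, d]) : Reducible G := by
  refine Plan.degreeFour.reducible v [a, b, c, d] [0] [] [1, 2, 3, 4] [] hl
    ?_ ?_ ?_ ?_ (show Plan.check 5 _ _ _ _ _ = true by decide +kernel) <;> simp [*]

theorem reducible_of_five_of_cherry {v a b c d e : V} (hl : [v, a, b, c, d, e].Nodup)
    (hN : ∀ w, G.Adj v w ↔ w ∈ [a, b, c, d, e]) (hab : ¬ G.Adj a b) (hac : ¬ G.Adj a c) :
    Reducible G := by
  refine Plan.degreeFiveCherry.reducible v [a, b, c, d, e] [0] [] [1, 2, 3, 4, 5] [12, 13] hl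
    ?_ ?_ ?_ ?_ (show Plan.check 6 _ _ _ _ _ = true by decide +kernel) <;> simp [*]

theorem reducible_of_five_of_gaps {v a b c d e : V} (hl : [v, a, b, c, d, e].Nodup)
    (hN : ∀ w, G.Adj v w ↔ w ∈ [a, b, c, d, e]) (hab : ¬ G.Adj a b) (hcd : ¬ G.Adj c d)
    (hG : G.Adj a c ∧ G.Adj a d ∧ G.Adj a e ∧ G.Adj b c ∧ G.Adj b d ∧ G.Adj b e ∧ G.Adj c e ∧
      G.Adj d e) : Reducible G := by
  refine Plan.degreeFiveGaps.reducible v [a, b, c, d, e] [0] []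
    [1, 2, 3, 4, 5, 13, 14, 15, 23, 24, 25, 35, 45] [12, 34] hl
    ?_ ?_ ?_ ?_ (show Plan.check 6 _ _ _ _ _ = true by decide +kernel) <;> simp [*]

theorem reducible_of_six_of_cherry {v a b c d e g : V} (hl : [v, a, b, c, d, e, g].Nodup)
    (hN : ∀ w, G.Adj v w ↔ w ∈ [a, b, c, d, e, g]) (hab : ¬ G.Adj a b) (hac : ¬ G.Adj a c) :
    Reducible G := by
  refine Plan.degreeSixCherry.reducible v [a, b, c, d, e, g] [0] [] [1, 2, 3, 4, 5, 6] [12, 13] hl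
    ?_ ?_ ?_ ?_ (show Plan.check 7 _ _ _ _ _ = true by decide +kernel) <;> simp [*]

theorem reducible_of_twins_six {v u a b c d e g : V} (hl : [v, u, a, b, c, d, e, g].Nodup)
    (hv : ∀ w, G.Adj v w ↔ w ∈ [a, b, c, d, e, g]) (hu : ∀ w, G.Adj u w ↔ w ∈ [a, b, c, d, e, g])
    (hG : Cocktail G a b c d e g) : Reducible G := by
  have hl' := hl
  simp only [List.nodup_cons, List.mem_cons, not_or, List.not_mem_nil, List.nodup_nil] at hl'
  unfold Cocktail at hG
  refine Plan.sixSix.reducible v [u, a, b, c, d, e, g] [0, 1] []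
    [2, 3, 4, 5, 6, 7, 12, 13, 14, 15, 16, 17, 24, 25, 26, 27, 34, 35, 36, 37, 46, 47, 56, 57] [1]
    hl ?_ ?_ ?_ ?_ (show Plan.check 8 _ _ _ _ _ = true by decide +kernel) <;> simp [*]

theorem reducible_of_six_five_sharing_five {v u a b c d e g : V}
    (hl : [v, u, a, b, c, d, e, g].Nodup) (hv : ∀ w, G.Adj v w ↔ w ∈ [a, b, c, d, e, g])
    (hu : ∀ w, G.Adj u w ↔ w ∈ [b, c, d, e, g]) (hG : Cocktail G a b c d e g) : Reducible G := by
  have hl' := hl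
  simp only [List.nodup_cons, List.mem_cons, not_or, List.not_mem_nil, List.nodup_nil] at hl'
  unfold Cocktail at hG
  refine Plan.sixFive.reducible v [u, a, b, c, d, e, g] [0, 1] []
    [2, 3, 4, 5, 6, 7, 13, 14, 15, 16, 17, 24, 25, 26, 27, 34, 35, 36, 37, 46, 47, 56, 57] [1, 12]
    hl ?_ ?_ ?_ ?_ (show Plan.check 8 _ _ _ _ _ = true by decide +kernel) <;> simp [*]

theorem reducible_of_six_six_sharing_five {v u a b c d e g h : V}
    (hl : [v, u, a, b, c, d, e, g, h].Nodup) (hv : ∀ w, G.Adj v w ↔ w ∈ [a, b, c, d, e, g])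
    (hu : ∀ w, G.Adj u w ↔ w ∈ [b, c, d, e, g, h]) (hG : Cocktail G a b c d e g) :
    Reducible G := by
  have hl' := hl
  simp only [List.nodup_cons, List.mem_cons, not_or, List.not_mem_nil, List.nodup_nil] at hl'
  unfold Cocktail at hG
  refine Plan.sixSixShift.reducible v [u, a, b, c, d, e, g, h] [0, 1] []
    [2, 3, 4, 5, 6, 7, 13, 14, 15, 16, 17, 18, 24, 25, 26, 27, 34, 35, 36, 37, 46, 47, 56, 57]
    [1, 8, 12] hl ?_ ?_ ?_ ?_ (show Plan.check 9 _ _ _ _ _ = true by decide +kernel) <;>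
    simp [*] <;> grind [G.adj_comm]

theorem reducible_of_six_five_missing_pair {v u a b c d e g h : V}
    (hl : [v, u, a, b, c, d, e, g, h].Nodup) (hv : ∀ w, G.Adj v w ↔ w ∈ [a, b, c, d, e, g])
    (hu : ∀ w, G.Adj u w ↔ w ∈ [c, d, e, g, h]) (hG : Cocktail G a b c d e g) :
    Reducible G := by
  have hl' := hl
  simp only [List.nodup_cons, List.mem_cons, not_or, List.not_mem_nil, List.nodup_nil] at hl'
  unfold Cocktail at hG
  refine Plan.sixFiveFourA.reducible v [u, a, b, c, d, e, g, h] [0, 1] []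
    [2, 3, 4, 5, 6, 7, 14, 15, 16, 17, 18, 24, 25, 26, 27, 34, 35, 36, 37, 46, 47, 56, 57]
    [1, 8, 12, 13] hl ?_ ?_ ?_ ?_ (show Plan.check 9 _ _ _ _ _ = true by decide +kernel) <;>
    simp [*] <;> grind [G.adj_comm]

theorem reducible_of_six_five_missing_edge {v u a b c d e g h : V}
    (hl : [v, u, a, b, c, d, e, g, h].Nodup) (hv : ∀ w, G.Adj v w ↔ w ∈ [a, b, c, d, e, g])
    (hu : ∀ w, G.Adj u w ↔ w ∈ [b, d, e, g, h]) (hG : Cocktail G a b c d e g) :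
    Reducible G := by
  have hl' := hl
  simp only [List.nodup_cons, List.mem_cons, not_or, List.not_mem_nil, List.nodup_nil] at hl'
  unfold Cocktail at hG
  refine Plan.sixFiveFourB.reducible v [u, a, b, c, d, e, g, h] [0, 1] []
    [2, 3, 4, 5, 6, 7, 13, 15, 16, 17, 18, 24, 25, 26, 27, 34, 35, 36, 37, 46, 47, 56, 57]
    [1, 8, 12, 14] hl ?_ ?_ ?_ ?_ (show Plan.check 9 _ _ _ _ _ = true by decide +kernel) <;>
    simp [*] <;> grind [G.adj_comm]

theorem reducible_of_twins_five {v u a b c d e : V} (hl : [v, u, a, b, c, d, e].Nodup)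
    (hv : ∀ w, G.Adj v w ↔ w ∈ [a, b, c, d, e]) (hu : ∀ w, G.Adj u w ↔ w ∈ [a, b, c, d, e])
    (hG : NearClique G a b c d e) : Reducible G := by
  have hl' := hl
  simp only [List.nodup_cons, List.mem_cons, not_or, List.not_mem_nil, List.nodup_nil] at hl'
  unfold NearClique at hG
  refine Plan.fiveFive.reducible v [u, a, b, c, d, e] [0, 1] []
    [2, 3, 4, 5, 6, 12, 13, 14, 15, 16, 24, 25, 26, 34, 35, 36, 45, 46, 56] [1]
    hl ?_ ?_ ?_ ?_ (show Plan.check 7 _ _ _ _ _ = true by decide +kernel) <;> simp [*]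

theorem reducible_of_five_five_missing_end {v u a b c d e h : V}
    (hl : [v, u, a, b, c, d, e, h].Nodup) (hv : ∀ w, G.Adj v w ↔ w ∈ [a, b, c, d, e])
    (hu : ∀ w, G.Adj u w ↔ w ∈ [b, c, d, e, h]) (hG : NearClique G a b c d e) : Reducible G := by
  have hl' := hl
  simp only [List.nodup_cons, List.mem_cons, not_or, List.not_mem_nil, List.nodup_nil] at hl'
  unfold NearClique at hG
  refine Plan.fiveFiveFourA.reducible v [u, a, b, c, d, e, h] [0, 1] []
    [2, 3, 4, 5, 6, 13, 14, 15, 16, 17, 24, 25, 26, 34, 35, 36, 45, 46, 56] [1, 7, 12]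
    hl ?_ ?_ ?_ ?_ (show Plan.check 8 _ _ _ _ _ = true by decide +kernel) <;>
    simp [*] <;> grind [G.adj_comm]

theorem reducible_of_five_five_missing_center {v u a b c d e h : V}
    (hl : [v, u, a, b, c, d, e, h].Nodup) (hv : ∀ w, G.Adj v w ↔ w ∈ [a, b, c, d, e])
    (hu : ∀ w, G.Adj u w ↔ w ∈ [a, b, d, e, h]) (hG : NearClique G a b c d e) : Reducible G := by
  have hl' := hl
  simp only [List.nodup_cons, List.mem_cons, not_or, List.not_mem_nil, List.nodup_nil] at hl'
  unfold NearClique at hG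
  refine Plan.fiveFiveFourB.reducible v [u, a, b, c, d, e, h] [0, 1] []
    [2, 3, 4, 5, 6, 12, 13, 15, 16, 17, 24, 25, 26, 34, 35, 36, 45, 46, 56] [1, 7, 14]
    hl ?_ ?_ ?_ ?_ (show Plan.check 8 _ _ _ _ _ = true by decide +kernel) <;>
    simp [*] <;> grind [G.adj_comm]

theorem reducible_of_leaf_six {v x b c d e g : V} (hl : [v, x, b, c, d, e, g].Nodup)
    (hv : ∀ w, G.Adj v w ↔ w ∈ [x, b, c, d, e, g]) (hx : ∀ w, G.Adj x w → w ∈ [v, x, b, c, d, e, g])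
    (hG : Cocktail G x b c d e g) : Reducible G := by
  have hl' := hl
  simp only [List.nodup_cons, List.mem_cons, not_or, List.not_mem_nil, List.nodup_nil] at hl'
  simp only [List.mem_cons, List.not_mem_nil, or_false] at hx
  unfold Cocktail at hG
  refine Plan.leafSixNone.reducible v [x, b, c, d, e, g] [0, 1] []
    [1, 2, 3, 4, 5, 6, 13, 14, 15, 16, 23, 24, 25, 26, 35, 36, 45, 46] []
    hl ?_ ?_ ?_ ?_ (show Plan.check 7 _ _ _ _ _ = true by decide +kernel) <;>
    simp [*]; exact hx

theorem reducible_of_leaf_six_extra {v x b c d e g h : V} (hl : [v, x, b, c, d, e, g, h].Nodup)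
    (hv : ∀ w, G.Adj v w ↔ w ∈ [x, b, c, d, e, g])
    (hx : ∀ w, G.Adj x w → w ∈ [v, x, b, c, d, e, g, h]) (hxh : G.Adj x h)
    (hG : Cocktail G x b c d e g) : Reducible G := by
  have hl' := hl
  simp only [List.nodup_cons, List.mem_cons, not_or, List.not_mem_nil, List.nodup_nil] at hl'
  simp only [List.mem_cons, List.not_mem_nil, or_false] at hx
  unfold Cocktail at hG
  refine Plan.leafSixOne.reducible v [x, b, c, d, e, g, h] [0, 1] []
    [1, 2, 3, 4, 5, 6, 13, 14, 15, 16, 17, 23, 24, 25, 26, 35, 36, 45, 46] [7]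
    hl ?_ ?_ ?_ ?_ (show Plan.check 8 _ _ _ _ _ = true by decide +kernel) <;>
    simp [*] <;> first | exact hx | grind [G.adj_comm]

theorem reducible_of_leaf_five_end {v x b c d e : V} (hl : [v, x, b, c, d, e].Nodup)
    (hv : ∀ w, G.Adj v w ↔ w ∈ [x, b, c, d, e]) (hx : ∀ w, G.Adj x w → w ∈ [v, x, b, c, d, e])
    (hG : NearClique G x b c d e) : Reducible G := by
  have hl' := hl
  simp only [List.nodup_cons, List.mem_cons, not_or, List.not_mem_nil, List.nodup_nil] at hl'
  simp only [List.mem_cons, List.not_mem_nil, or_false] at hx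
  unfold NearClique at hG
  refine Plan.leafFiveNoneA.reducible v [x, b, c, d, e] [0, 1] []
    [1, 2, 3, 4, 5, 13, 14, 15, 23, 24, 25, 34, 35, 45] []
    hl ?_ ?_ ?_ ?_ (show Plan.check 6 _ _ _ _ _ = true by decide +kernel) <;>
    simp [*]; exact hx

theorem reducible_of_leaf_five_end_extra {v x b c d e h : V} (hl : [v, x, b, c, d, e, h].Nodup)
    (hv : ∀ w, G.Adj v w ↔ w ∈ [x, b, c, d, e]) (hx : ∀ w, G.Adj x w → w ∈ [v, x, b, c, d, e, h])
    (hxh : G.Adj x h) (hG : NearClique G x b c d e) : Reducible G := by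
  have hl' := hl
  simp only [List.nodup_cons, List.mem_cons, not_or, List.not_mem_nil, List.nodup_nil] at hl'
  simp only [List.mem_cons, List.not_mem_nil, or_false] at hx
  unfold NearClique at hG
  refine Plan.leafFiveOneA.reducible v [x, b, c, d, e, h] [0, 1] []
    [1, 2, 3, 4, 5, 13, 14, 15, 16, 23, 24, 25, 34, 35, 45] [6]
    hl ?_ ?_ ?_ ?_ (show Plan.check 7 _ _ _ _ _ = true by decide +kernel) <;>
    simp [*] <;> first | exact hx | grind [G.adj_comm]

theorem reducible_of_leaf_five_end_two_extra {v x b c d e h k : V}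
    (hl : [v, x, b, c, d, e, h, k].Nodup) (hv : ∀ w, G.Adj v w ↔ w ∈ [x, b, c, d, e])
    (hx : ∀ w, G.Adj x w → w ∈ [v, x, b, c, d, e, h, k]) (hxh : G.Adj x h) (hxk : G.Adj x k)
    (hG : NearClique G x b c d e) : Reducible G := by
  have hl' := hl
  simp only [List.nodup_cons, List.mem_cons, not_or, List.not_mem_nil, List.nodup_nil] at hl'
  simp only [List.mem_cons, List.not_mem_nil, or_false] at hx
  unfold NearClique at hG
  refine Plan.leafFiveTwoA.reducible v [x, b, c, d, e, h, k] [0, 1] []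
    [1, 2, 3, 4, 5, 13, 14, 15, 16, 17, 23, 24, 25, 34, 35, 45] [6, 7]
    hl ?_ ?_ ?_ ?_ (show Plan.check 8 _ _ _ _ _ = true by decide +kernel) <;>
    simp [*] <;> first | exact hx | grind [G.adj_comm]

theorem reducible_of_leaf_five_center {v x a b d e : V} (hl : [v, x, a, b, d, e].Nodup)
    (hv : ∀ w, G.Adj v w ↔ w ∈ [x, a, b, d, e]) (hx : ∀ w, G.Adj x w → w ∈ [v, x, a, b, d, e])
    (hG : NearClique G a b x d e) : Reducible G := by
  have hl' := hl
  simp only [List.nodup_cons, List.mem_cons, not_or, List.not_mem_nil, List.nodup_nil] at hl'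
  simp only [List.mem_cons, List.not_mem_nil, or_false] at hx
  unfold NearClique at hG
  refine Plan.leafFiveNoneB.reducible v [x, a, b, d, e] [0, 1] []
    [1, 2, 3, 4, 5, 12, 13, 14, 15, 24, 25, 34, 35, 45] []
    hl ?_ ?_ ?_ ?_ (show Plan.check 6 _ _ _ _ _ = true by decide +kernel) <;>
    simp [*] <;> first | exact hx | grind [G.adj_comm]

theorem reducible_of_leaf_five_center_extra {v x a b d e h : V} (hl : [v, x, a, b, d, e, h].Nodup)
    (hv : ∀ w, G.Adj v w ↔ w ∈ [x, a, b, d, e]) (hx : ∀ w, G.Adj x w → w ∈ [v, x, a, b, d, e, h])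
    (hxh : G.Adj x h) (hG : NearClique G a b x d e) : Reducible G := by
  have hl' := hl
  simp only [List.nodup_cons, List.mem_cons, not_or, List.not_mem_nil, List.nodup_nil] at hl'
  simp only [List.mem_cons, List.not_mem_nil, or_false] at hx
  unfold NearClique at hG
  refine Plan.leafFiveOneB.reducible v [x, a, b, d, e, h] [0, 1] []
    [1, 2, 3, 4, 5, 12, 13, 14, 15, 16, 24, 25, 34, 35, 45] [6]
    hl ?_ ?_ ?_ ?_ (show Plan.check 7 _ _ _ _ _ = true by decide +kernel) <;>
    simp [*] <;> first | exact hx | grind [G.adj_comm]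

theorem reducible_of_leaf_five_center_two_extra {v x a b d e h k : V}
    (hl : [v, x, a, b, d, e, h, k].Nodup) (hv : ∀ w, G.Adj v w ↔ w ∈ [x, a, b, d, e])
    (hx : ∀ w, G.Adj x w → w ∈ [v, x, a, b, d, e, h, k]) (hxh : G.Adj x h) (hxk : G.Adj x k)
    (hG : NearClique G a b x d e) : Reducible G := by
  have hl' := hl
  simp only [List.nodup_cons, List.mem_cons, not_or, List.not_mem_nil, List.nodup_nil] at hl'
  simp only [List.mem_cons, List.not_mem_nil, or_false] at hx
  unfold NearClique at hG
  refine Plan.leafFiveTwoB.reducible v [x, a, b, d, e, h, k] [0, 1] []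
    [1, 2, 3, 4, 5, 12, 13, 14, 15, 16, 17, 24, 25, 34, 35, 45] [6, 7]
    hl ?_ ?_ ?_ ?_ (show Plan.check 8 _ _ _ _ _ = true by decide +kernel) <;>
    simp [*] <;> first | exact hx | grind [G.adj_comm]

theorem reducible_of_gap_in_common {v u a b c d e h k : V} (hl : [v, u, a, b, c, d, e, h, k].Nodup)
    (hv : ∀ w, G.Adj v w ↔ w ∈ [a, b, c, d, e]) (hu : ∀ w, G.Adj u w ↔ w ∈ [a, b, c, h, k])
    (hv₅ : AtMostOneGap G v) (hu₅ : AtMostOneGap G u) (hab : ¬ G.Adj a b)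
    (hG : G.Adj a d ∧ G.Adj a e ∧ G.Adj b d ∧ G.Adj b e ∧ G.Adj c d ∧ G.Adj c e ∧ G.Adj d e) :
    Reducible G := by
  have hl' := hl
  simp only [List.nodup_cons, List.mem_cons, not_or, List.not_mem_nil, List.nodup_nil] at hl'
  refine Plan.threeGapA.reducible v [u, a, b, c, d, e, h, k] [0, 1] [0, 1]
    [2, 3, 4, 5, 6, 12, 13, 14, 17, 18, 25, 26, 35, 36, 45, 46, 56] [1, 7, 8, 15, 16, 23]
    hl ?_ ?_ ?_ ?_ (show Plan.check 9 _ _ _ _ _ = true by decide +kernel) <;>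
    simp [*] <;> grind [G.adj_comm]

theorem reducible_of_gap_across {v u a b c d e h k : V} (hl : [v, u, a, b, c, d, e, h, k].Nodup)
    (hv : ∀ w, G.Adj v w ↔ w ∈ [a, b, c, d, e]) (hu : ∀ w, G.Adj u w ↔ w ∈ [a, b, c, h, k])
    (hv₅ : AtMostOneGap G v) (hu₅ : AtMostOneGap G u) (had : ¬ G.Adj a d)
    (hG : G.Adj a e ∧ G.Adj b d ∧ G.Adj b e ∧ G.Adj c d ∧ G.Adj c e ∧ G.Adj d e) :
    Reducible G := by
  have hl' := hl
  simp only [List.nodup_cons, List.mem_cons, not_or, List.not_mem_nil, List.nodup_nil] at hl'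
  refine Plan.threeGapB.reducible v [u, a, b, c, d, e, h, k] [0, 1] [0, 1]
    [2, 3, 4, 5, 6, 12, 13, 14, 17, 18, 26, 35, 36, 45, 46, 56] [1, 7, 8, 15, 16, 25]
    hl ?_ ?_ ?_ ?_ (show Plan.check 9 _ _ _ _ _ = true by decide +kernel) <;>
    simp [*] <;> grind [G.adj_comm]

theorem reducible_of_gap_private {v u a b c d e h k : V} (hl : [v, u, a, b, c, d, e, h, k].Nodup)
    (hv : ∀ w, G.Adj v w ↔ w ∈ [a, b, c, d, e]) (hu : ∀ w, G.Adj u w ↔ w ∈ [a, b, c, h, k])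
    (hv₅ : AtMostOneGap G v) (hu₅ : AtMostOneGap G u) (hde : ¬ G.Adj d e)
    (hG : G.Adj a d ∧ G.Adj a e ∧ G.Adj b d ∧ G.Adj b e ∧ G.Adj c d ∧ G.Adj c e) :
    Reducible G := by
  have hl' := hl
  simp only [List.nodup_cons, List.mem_cons, not_or, List.not_mem_nil, List.nodup_nil] at hl'
  refine Plan.threeGapC.reducible v [u, a, b, c, d, e, h, k] [0, 1] [0, 1]
    [2, 3, 4, 5, 6, 12, 13, 14, 17, 18, 25, 26, 35, 36, 45, 46] [1, 7, 8, 15, 16, 56]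
    hl ?_ ?_ ?_ ?_ (show Plan.check 9 _ _ _ _ _ = true by decide +kernel) <;>
    simp [*] <;> grind [G.adj_comm]

theorem reducible_of_two_leaves {v u a b c d e h k : V} (hl : [v, u, a, b, c, d, e, h, k].Nodup)
    (hv : ∀ w, G.Adj v w ↔ w ∈ [a, b, c, d, e]) (hu : ∀ w, G.Adj u w ↔ w ∈ [a, b, c, h, k])
    (ha : ∀ w, G.Adj a w → w ∈ [v, u, b, c, d, e, h, k])
    (hvc : ∀ x ∈ [a, b, c, d, e], ∀ y ∈ [a, b, c, d, e], x ≠ y → G.Adj x y)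
    (huc : ∀ x ∈ [a, b, c, h, k], ∀ y ∈ [a, b, c, h, k], x ≠ y → G.Adj x y) :
    Reducible G := by
  have hl' := hl
  simp only [List.nodup_cons, List.mem_cons, not_or, List.not_mem_nil, List.nodup_nil] at hl'
  simp only [List.forall_mem_cons] at hvc huc
  refine Plan.threeClosed.reducible v [u, a, b, c, d, e, h, k] [0, 1, 2] []
    [2, 3, 4, 5, 6, 12, 13, 14, 17, 18, 23, 24, 25, 26, 27, 28, 34, 35, 36, 37, 38, 45, 46, 47, 48,
      56, 78] [1, 7, 8, 15, 16]
    hl ?_ ?_ ?_ ?_ (show Plan.check 9 _ _ _ _ _ = true by decide +kernel) <;>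
    simp [*] <;> grind [G.adj_comm]

theorem reducible_of_three_leaves {v u z a b c d e h k : V}
    (hl : [v, u, a, b, c, d, e, h, k, z].Nodup)
    (hv : ∀ w, G.Adj v w ↔ w ∈ [a, b, c, d, e]) (hu : ∀ w, G.Adj u w ↔ w ∈ [a, b, c, h, k])
    (hz : ∀ w, G.Adj z w ↔ w ∈ [a, d, e, h, k])
    (hvc : ∀ x ∈ [a, b, c, d, e], ∀ y ∈ [a, b, c, d, e], x ≠ y → G.Adj x y)
    (huc : ∀ x ∈ [a, b, c, h, k], ∀ y ∈ [a, b, c, h, k], x ≠ y → G.Adj x y)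
    (hzc : ∀ x ∈ [a, d, e, h, k], ∀ y ∈ [a, d, e, h, k], x ≠ y → G.Adj x y) :
    Reducible G := by
  have hl' := hl
  simp only [List.nodup_cons, List.mem_cons, not_or, List.not_mem_nil, List.nodup_nil] at hl'
  simp only [List.forall_mem_cons] at hvc huc hzc
  refine Plan.threeLeaves.reducible v [u, a, b, c, d, e, h, k, z] [0, 1, 9] []
    [2, 3, 4, 5, 6, 12, 13, 14, 17, 18, 23, 24, 25, 26, 27, 28, 29, 34, 35, 36, 37, 38, 45, 46, 47,
      48, 56, 57, 58, 59, 67, 68, 69, 78, 79, 89] [1, 7, 8, 9, 15, 16, 19, 39, 49]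
    hl ?_ ?_ ?_ ?_ (show Plan.check 10 _ _ _ _ _ = true by decide +kernel) <;>
    simp [*] <;> grind [G.adj_comm]

end Configurations

section Local

variable {G : SimpleGraph V}

/-- No neighbour of `v` is non-adjacent to two other neighbours of `v`. -/
def NoCherry (G : SimpleGraph V) (v : V) : Prop :=
  ∀ a b c, G.Adj v a → G.Adj v b → G.Adj v c → a ≠ b → a ≠ c → b ≠ c → ¬ G.Adj a b → G.Adj a c

theorem nearClique_of_gap {v a b c d e : V} (hnd : [v, a, b, c, d, e].Nodup)
    (hN : ∀ w, G.Adj v w ↔ w ∈ [a, b, c, d, e])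
    (h : ∀ x z, G.Adj v x → G.Adj v z → x ≠ z → ¬ G.Adj x z → s(x, z) = s(a, b)) :
    NearClique G a b c d e := by
  have key : ∀ x ∈ [a, b, c, d, e], ∀ z ∈ [a, b, c, d, e], x ≠ z → s(x, z) ≠ s(a, b) →
      G.Adj x z := fun x hx z hz hxz hne => by
    by_contra hn
    exact hne (h x z ((hN x).2 hx) ((hN z).2 hz) hxz hn)
  simp only [List.nodup_cons, List.mem_cons, not_or, List.not_mem_nil, List.nodup_nil] at hnd
  simp only [List.forall_mem_cons, ne_eq, Sym2.eq_iff] at key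
  unfold NearClique
  grind

/-- Four neighbours of a vertex without cherries can be paired off so that vertices from
different pairs are adjacent. -/
theorem exists_pairing_four {v a b c d : V} (h : NoCherry G v) (hnd : [a, b, c, d].Nodup)
    (ha : G.Adj v a) (hb : G.Adj v b) (hc : G.Adj v c) (hd : G.Adj v d) :
    ∃ b' c' d', [b', c', d'].Perm [b, c, d] ∧
      G.Adj a c' ∧ G.Adj a d' ∧ G.Adj b' c' ∧ G.Adj b' d' := by
  have h₁ : [c, b, d].Perm [b, c, d] := List.Perm.swap b c [d]
  have h₂ : [d, b, c].Perm [b, c, d] :=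
    (List.Perm.swap b d [c]).trans ((List.Perm.swap c d []).cons b)
  simp only [List.nodup_cons, List.mem_cons, not_or, List.not_mem_nil, List.nodup_nil] at hnd
  by_cases hac : G.Adj a c ∧ G.Adj b d
  · by_cases had : G.Adj a d ∧ G.Adj b c
    · exact ⟨b, c, d, .refl _, hac.1, had.1, had.2, hac.2⟩
    · refine ⟨d, b, c, h₂, ?_⟩
      grind [NoCherry, G.adj_comm]
  · refine ⟨c, b, d, h₁, ?_⟩
    grind [NoCherry, G.adj_comm]

variable [Fintype V] [DecidableEq V] [DecidableRel G.Adj]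

/-- A list of distinct neighbours extends to a list of all neighbours. -/
theorem exists_neighbor_list {v : V} (s : List V) (hs : s.Nodup) (hsv : ∀ x ∈ s, G.Adj v x) :
    ∃ r : List V, r.length + s.length = G.degree v ∧ (v :: (s ++ r)).Nodup ∧
      ∀ w, G.Adj v w ↔ w ∈ s ++ r := by
  have hsub : s.toFinset ⊆ G.neighborFinset v := fun x hx => by
    simpa using hsv x (by simpa using hx)
  have hmem : ∀ w, G.Adj v w ↔ w ∈ s ++ (G.neighborFinset v \ s.toFinset).toList := by
    intro w
    by_cases hw : w ∈ s
    · simp [hw, hsv w hw]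
    · simp [hw]
  refine ⟨(G.neighborFinset v \ s.toFinset).toList, ?_, ?_, hmem⟩
  · rw [Finset.length_toList, Finset.card_sdiff_of_subset hsub, List.toFinset_card_of_nodup hs,
      card_neighborFinset_eq_degree]
    have := Finset.card_le_card hsub
    rw [List.toFinset_card_of_nodup hs, card_neighborFinset_eq_degree] at this
    omega
  · refine List.nodup_cons.2 ⟨fun h => G.irrefl ((hmem v).2 h), ?_⟩
    refine List.Nodup.append hs (Finset.nodup_toList _) fun x hx hx' => ?_
    simp [hx] at hx'

theorem five_le_degree (hG : ¬ Reducible G) {v : V} (hv : 0 < G.degree v) : 5 ≤ G.degree v := by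
  obtain ⟨r, hr, hnd, hN⟩ := exists_neighbor_list (G := G) (v := v) [] (by simp) (by simp)
  simp only [List.nil_append, List.length_nil, add_zero] at hr hnd hN
  by_contra! hlt
  rw [← hr] at hlt hv
  match r, hlt, hv, hnd, hN with
  | [a], _, _, hnd, hN => exact hG (reducible_of_degree_one hnd hN)
  | [a, b], _, _, hnd, hN => exact hG (reducible_of_degree_two hnd hN)
  | [a, b, c], _, _, hnd, hN => exact hG (reducible_of_degree_three hnd hN)
  | [a, b, c, d], _, _, hnd, hN => exact hG (reducible_of_degree_four hnd hN)
  | _ :: _ :: _ :: _ :: _ :: _, hlt, _, _, _ => simp at hlt; omega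

theorem noCherry_of_degree_six (hG : ¬ Reducible G) {v : V} (hv : G.degree v = 6) :
    NoCherry G v := by
  intro a b c ha hb hc hab hac hbc hnab
  by_contra hnac
  obtain ⟨r, hr, hnd, hN⟩ := exists_neighbor_list (G := G) (v := v) [a, b, c]
    (by simp [*]) (by simp [*])
  rw [hv] at hr
  obtain ⟨d, e, g, rfl⟩ := List.length_eq_three.1 (by simpa using hr : r.length = 3)
  exact hG (reducible_of_six_of_cherry hnd hN hnab hnac)

theorem noCherry_of_degree_five (hG : ¬ Reducible G) {v : V} (hv : G.degree v = 5) :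
    NoCherry G v := by
  intro a b c ha hb hc hab hac hbc hnab
  by_contra hnac
  obtain ⟨r, hr, hnd, hN⟩ := exists_neighbor_list (G := G) (v := v) [a, b, c]
    (by simp [*]) (by simp [*])
  rw [hv] at hr
  obtain ⟨d, e, rfl⟩ := List.length_eq_two.1 (by simpa using hr : r.length = 2)
  exact hG (reducible_of_five_of_cherry hnd hN hnab hnac)

theorem atMostOneGap_of_degree_five (hG : ¬ Reducible G) {v : V} (hv : G.degree v = 5) :
    AtMostOneGap G v := by
  have hch := noCherry_of_degree_five hG hv
  intro a b a' b' ha hb ha' hb' hab hab' hn hn'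
  by_contra hne
  rw [Sym2.eq_iff] at hne
  by_cases h₁ : a = a'
  · subst h₁
    exact hn' (hch a b b' ha hb hb' hab hab' (by tauto) hn)
  by_cases h₂ : a = b'
  · subst h₂
    exact hn' (hch a b a' ha hb ha' hab h₁ (by tauto) hn).symm
  by_cases h₃ : b = a'
  · subst h₃
    exact hn' (hch b a b' hb ha hb' hab.symm hab' h₂ (fun h => hn h.symm))
  by_cases h₄ : b = b'
  · subst h₄
    exact hn' (hch b a a' hb ha ha' hab.symm h₃ h₁ (fun h => hn h.symm)).symm
  obtain ⟨r, hr, hnd, hN⟩ := exists_neighbor_list (G := G) (v := v) [a, b, a', b']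
    (by simp [*]) (by simp [*])
  rw [hv] at hr
  obtain ⟨e, rfl⟩ := List.length_eq_one_iff.1 (by simpa using hr : r.length = 1)
  have he : G.Adj v e := (hN e).2 (by simp)
  have hnd' := hnd
  simp only [List.cons_append, List.nil_append, List.nodup_cons, List.mem_cons, not_or,
    List.not_mem_nil, List.nodup_nil] at hnd'
  have hnb : ¬ G.Adj b a := fun h => hn h.symm
  have hnb' : ¬ G.Adj b' a' := fun h => hn' h.symm
  refine hG (reducible_of_five_of_gaps hnd hN hn hn' ⟨?_, ?_, ?_, ?_, ?_, ?_, ?_, ?_⟩)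
  · exact hch a b a' ha hb ha' hab h₁ h₃ hn
  · exact hch a b b' ha hb hb' hab h₂ h₄ hn
  · exact hch a b e ha hb he hab (by tauto) (by tauto) hn
  · exact hch b a a' hb ha ha' hab.symm h₃ h₁ hnb
  · exact hch b a b' hb ha hb' hab.symm h₄ h₂ hnb
  · exact hch b a e hb ha he hab.symm (by tauto) (by tauto) hnb
  · exact hch a' b' e ha' hb' he hab' (by tauto) (by tauto) hn'
  · exact hch b' a' e hb' ha' he hab'.symm (by tauto) (by tauto) hnb'

/-- The neighbours of a vertex of degree five with at most one gap, the gap listed first. -/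
theorem exists_nearClique {v : V} (hv : G.degree v = 5) (h : AtMostOneGap G v) {y : V}
    (hy : G.Adj v y) :
    ∃ a b c d e, [v, a, b, c, d, e].Nodup ∧ (∀ w, G.Adj v w ↔ w ∈ [a, b, c, d, e]) ∧
      NearClique G a b c d e ∧ (y = a ∨ y = c) := by
  by_cases hgap : ∃ p q, G.Adj v p ∧ G.Adj v q ∧ p ≠ q ∧ ¬ G.Adj p q
  · by_cases hgap' : ∃ q, G.Adj v q ∧ y ≠ q ∧ ¬ G.Adj y q
    · obtain ⟨q, hq, hyq, hn⟩ := hgap'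
      obtain ⟨r, hr, hnd, hN⟩ := exists_neighbor_list (G := G) (v := v) [y, q]
        (by simp [*]) (by simp [*])
      rw [hv] at hr
      obtain ⟨c, d, e, rfl⟩ := List.length_eq_three.1 (by simpa using hr : r.length = 3)
      exact ⟨y, q, c, d, e, hnd, hN, nearClique_of_gap hnd hN
        fun x z hx hz hxz hn' => h x z y q hx hz hy hq hxz hyq hn' hn, Or.inl rfl⟩
    · obtain ⟨p, q, hp, hq, hpq, hn⟩ := hgap
      have hpy : p ≠ y := fun h' => hgap' ⟨q, hq, h' ▸ hpq, h' ▸ hn⟩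
      have hqy : q ≠ y := fun h' => hgap' ⟨p, hp, h' ▸ hpq.symm, fun h'' => hn (h' ▸ h''.symm)⟩
      obtain ⟨r, hr, hnd, hN⟩ := exists_neighbor_list (G := G) (v := v) [p, q, y]
        (by simp [*]) (by simp [*])
      rw [hv] at hr
      obtain ⟨d, e, rfl⟩ := List.length_eq_two.1 (by simpa using hr : r.length = 2)
      exact ⟨p, q, y, d, e, hnd, hN, nearClique_of_gap hnd hN
        fun x z hx hz hxz hn' => h x z p q hx hz hp hq hxz hpq hn' hn, Or.inr rfl⟩
  · obtain ⟨r, hr, hnd, hN⟩ := exists_neighbor_list (G := G) (v := v) [y] (by simp) (by simp [hy])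
    rw [hv] at hr
    match r, hr, hnd, hN with
    | [b, c, d, e], _, hnd, hN =>
      exact ⟨y, b, c, d, e, hnd, hN, nearClique_of_gap hnd hN
        fun x z hx hz hxz hn => absurd ⟨x, z, hx, hz, hxz, hn⟩ hgap, Or.inl rfl⟩
    | _ :: _ :: _ :: _ :: _ :: _, hr, _, _ => simp at hr

/-- The vertices among six neighbours without cherries can be matched compatibly. -/
theorem exists_partner {v : V} (hv : G.degree v = 6) (h : NoCherry G v) {y : V} (hy : G.Adj v y) :
    ∃ b, G.Adj v b ∧ b ≠ y ∧ ∀ x, G.Adj v x → x ≠ y → x ≠ b → G.Adj y x ∧ G.Adj b x := by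
  by_cases hgap : ∃ b, G.Adj v b ∧ b ≠ y ∧ ¬ G.Adj y b
  · obtain ⟨b, hb, hby, hn⟩ := hgap
    exact ⟨b, hb, hby, fun x hx hxy hxb => ⟨h y b x hy hb hx hby.symm hxy.symm hxb.symm hn,
      h b y x hb hy hx hby hxb.symm hxy.symm fun h' => hn h'.symm⟩⟩
  push Not at hgap
  suffices ∃ b, G.Adj v b ∧ b ≠ y ∧ ∀ x, G.Adj v x → x ≠ b → G.Adj b x by
    obtain ⟨b, hb, hby, hbx⟩ := this
    exact ⟨b, hb, hby, fun x hx hxy hxb => ⟨hgap x hx hxy, hbx x hx hxb⟩⟩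
  by_contra! hcon
  have hex : ∀ s : List V, s.Nodup → (∀ x ∈ s, G.Adj v x) → s.length < 6 →
      ∃ p, G.Adj v p ∧ p ∉ s := by
    intro s hs hsv hlt
    obtain ⟨r, hr, hnd, hN⟩ := exists_neighbor_list s hs hsv
    match r, hr, hnd, hN with
    | [], hr, _, _ => simp at hr; omega
    | p :: r, _, hnd, hN =>
      refine ⟨p, (hN p).2 (by simp), fun hp => ?_⟩
      exact (List.nodup_append.1 (List.nodup_cons.1 hnd).2).2.2 p hp p (by simp) rfl
  have hpart : ∀ p, G.Adj v p → p ≠ y → ∃ q, G.Adj v q ∧ q ≠ y ∧ q ≠ p ∧ ¬ G.Adj p q ∧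
      ∀ x, G.Adj v x → x ≠ p → x ≠ q → G.Adj p x ∧ G.Adj q x := by
    intro p hp hpy
    obtain ⟨q, hq, hqp, hn⟩ := hcon p hp hpy
    refine ⟨q, hq, ?_, hqp, hn, fun x hx hxp hxq =>
      ⟨h p q x hp hq hx hqp.symm hxp.symm hxq.symm hn,
      h q p x hq hp hx hqp hxq.symm hxp.symm fun h' => hn h'.symm⟩⟩
    rintro rfl
    exact hn (hgap p hp hpy).symm
  obtain ⟨p, hp, hps⟩ := hex [y] (by simp) (by simp [hy]) (by simp)
  obtain ⟨q, hq, hqy, hqp, hpq, hpq'⟩ := hpart p hp (by simpa using hps)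
  have h₁ : [y, p, q].Nodup := by grind
  obtain ⟨r, hr, hrs⟩ := hex [y, p, q] h₁ (by simp [*]) (by simp)
  obtain ⟨t, ht, hty, htr, hrt, hrt'⟩ := hpart r hr (by grind)
  have htpq : t ≠ p ∧ t ≠ q := by
    clear hcon hex hpart h hgap
    grind [G.adj_comm]
  obtain ⟨w, hw, hws⟩ := hex [y, p, q, r, t] (by grind) (by simp [*]) (by simp)
  obtain ⟨z, hz, hzy, hzw, hwz, hwz'⟩ := hpart w hw (by grind)
  have hz' : z ∉ [y, p, q, r, t] := by
    have hpw := hpq' w hw (by grind) (by grind)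
    have hrw := hrt' w hw (by grind) (by grind)
    clear hcon hex hpart h hgap hpq' hrt' hwz'
    grind [G.adj_comm]
  obtain ⟨l, hl, hnd, -⟩ := exists_neighbor_list (G := G) (v := v) [y, p, q, r, t, w, z] (by grind)
    (by simp [*])
  simp at hl
  omega

/-- The neighbours of a vertex of degree six without cherries, listed in pairs. -/
theorem exists_cocktail {v : V} (hv : G.degree v = 6) (h : NoCherry G v) {y z : V}
    (hy : G.Adj v y) (hz : G.Adj v z) (hyz : y ≠ z) :
    ∃ b c d e g, [v, y, b, c, d, e, g].Nodup ∧ (∀ w, G.Adj v w ↔ w ∈ [y, b, c, d, e, g]) ∧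
      Cocktail G y b c d e g ∧ (z = b ∨ z = c) := by
  obtain ⟨b, hb, hby, hyb⟩ := exists_partner hv h hy
  obtain ⟨c, d, e, g, hnd, hN, hzc⟩ : ∃ c d e g, [v, y, b, c, d, e, g].Nodup ∧
      (∀ w, G.Adj v w ↔ w ∈ [y, b, c, d, e, g]) ∧ (z = b ∨ z = c) := by
    by_cases hzb : z = b
    · obtain ⟨r, hr, hnd, hN⟩ := exists_neighbor_list (G := G) (v := v) [y, b]
        (by simp [hby.symm]) (by simp [*])
      rw [hv] at hr
      match r, hr, hnd, hN with
      | [c, d, e, g], _, hnd, hN => exact ⟨c, d, e, g, hnd, hN, Or.inl hzb⟩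
      | _ :: _ :: _ :: _ :: _ :: _, hr, _, _ => simp at hr
    · obtain ⟨r, hr, hnd, hN⟩ := exists_neighbor_list (G := G) (v := v) [y, b, z]
        (by simp [hby.symm, hyz, Ne.symm hzb]) (by simp [*])
      rw [hv] at hr
      obtain ⟨d, e, g, rfl⟩ := List.length_eq_three.1 (by simpa using hr : r.length = 3)
      exact ⟨z, d, e, g, hnd, hN, Or.inr rfl⟩
  have hv' : ∀ w ∈ [y, b, c, d, e, g], G.Adj v w := fun w => (hN w).2
  simp only [List.forall_mem_cons] at hv'
  obtain ⟨-, -, hc, hd, he, hg, -⟩ := hv'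
  have hnd₄ : [c, d, e, g].Nodup := hnd.sublist (List.drop_sublist 3 [v, y, b, c, d, e, g])
  obtain ⟨d', e', g', hperm, h₁, h₂, h₃, h₄⟩ := exists_pairing_four h hnd₄ hc hd he hg
  have hperm' : [v, y, b, c, d', e', g'].Perm [v, y, b, c, d, e, g] :=
    (((hperm.cons c).cons b).cons y).cons v
  have hnd' := hperm'.nodup_iff.2 hnd
  have hN' : ∀ w, G.Adj v w ↔ w ∈ [y, b, c, d', e', g'] := fun w =>
    (hN w).trans (((hperm.cons c).cons b).cons y).mem_iff.symm
  refine ⟨b, c, d', e', g', hnd', hN', ⟨?_, h₁, h₂, h₃, h₄⟩, hzc⟩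
  have key : ∀ w ∈ [c, d', e', g'], G.Adj y w ∧ G.Adj b w := by
    intro w hw
    refine hyb w ((hN' w).2 (by simp at hw ⊢; tauto)) ?_ ?_
    · rintro rfl
      exact (List.nodup_cons.1 (List.nodup_cons.1 hnd').2).1 (List.mem_cons_of_mem _ hw)
    · rintro rfl
      exact (List.nodup_cons.1 (List.nodup_cons.1 (List.nodup_cons.1 hnd').2).2).1 hw
  simp only [List.forall_mem_cons] at key
  tauto

end Local

section Pairs

theorem nodup_insert_second {u v : V} {l : List V} (huv : u ≠ v) (hul : u ∉ l)
    (h : (v :: l).Nodup) : (v :: u :: l).Nodup := by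
  rw [List.nodup_cons] at h
  simp [huv.symm, hul, h.1, h.2]

theorem nodup_concat {h : V} {l : List V} (hh : h ∉ l) (hl : l.Nodup) : (l ++ [h]).Nodup := by
  refine hl.append (List.nodup_singleton h) ?_
  simpa using hh

theorem mem_of_nodup_append {l m : List V} (h : (l ++ m).Nodup) {w : V} :
    w ∈ l ++ m ∧ w ∉ l ↔ w ∈ m := by
  have := List.disjoint_of_nodup_append h
  simp only [List.mem_append]
  exact ⟨fun h => h.1.resolve_left h.2, fun hm => ⟨.inr hm, fun hl => this hl hm⟩⟩

theorem mem_of_nodup_skip {a b c : V} {m : List V} (h : (a :: b :: c :: m).Nodup) {w : V} :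
    w ∈ a :: b :: c :: m ∧ (w ≠ a ∧ w ≠ c) ↔ w ∈ b :: m := by
  simp only [List.nodup_cons, List.mem_cons, not_or] at h ⊢
  obtain ⟨⟨h₁, h₂, h₃⟩, ⟨h₄, h₅⟩, h₆, -⟩ := h
  constructor
  · tauto
  · rintro (rfl | hw)
    · exact ⟨.inr (.inl rfl), h₁ ∘ Eq.symm, h₄⟩
    · refine ⟨.inr (.inr (.inr hw)), ?_, ?_⟩
      · rintro rfl; exact h₃ hw
      · rintro rfl; exact h₆ hw

variable {G : SimpleGraph V} [Fintype V] [DecidableRel G.Adj]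

theorem exists_adj_ne {v : V} (hv : 2 ≤ G.degree v) : ∃ y z, G.Adj v y ∧ G.Adj v z ∧ y ≠ z := by
  rw [← card_neighborFinset_eq_degree] at hv
  obtain ⟨y, hy, z, hz, hyz⟩ := Finset.one_lt_card.1 hv
  exact ⟨y, z, by simpa using hy, by simpa using hz, hyz⟩

variable [DecidableEq V]

/-- Counting for two neighbourhoods with a small union. -/
theorem card_neighborFinset_sdiff {u v : V} :
    (G.neighborFinset v \ G.neighborFinset u).card + G.degree u =
      (G.neighborFinset u \ G.neighborFinset v).card + G.degree v := by
  have h₁ := Finset.card_sdiff_add_card_inter (G.neighborFinset v) (G.neighborFinset u)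
  have h₂ := Finset.card_sdiff_add_card_inter (G.neighborFinset u) (G.neighborFinset v)
  rw [Finset.inter_comm] at h₂
  simp only [card_neighborFinset_eq_degree] at h₁ h₂
  omega

theorem card_sdiff_neighborFinset_le {u v : V} {B : Finset V} (hu : ∀ w, G.Adj u w → w ∈ B)
    (hv : ∀ w, G.Adj v w → w ∈ B) :
    (G.neighborFinset u \ G.neighborFinset v).card + G.degree v ≤ B.card := by
  rw [← card_neighborFinset_eq_degree, Finset.card_sdiff_add_card]
  refine Finset.card_le_card fun w hw => ?_
  simp only [Finset.mem_union, mem_neighborFinset] at hw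
  exact hw.elim (hu w) (hv w)

/-- The neighbourhood of `u` in terms of that of `v`. -/
theorem adj_iff_of_sdiff {u v : V} {S T : Finset V}
    (hS : G.neighborFinset v \ G.neighborFinset u = S)
    (hT : G.neighborFinset u \ G.neighborFinset v = T) (w : V) :
    G.Adj u w ↔ (G.Adj v w ∧ w ∉ S) ∨ w ∈ T := by
  subst hS hT
  simp only [Finset.mem_sdiff, mem_neighborFinset]
  tauto

theorem degree_ne_six (hG : ¬ Reducible G) {u v : V} (hne : u ≠ v) (huv : ¬ G.Adj u v)
    {B : Finset V} (hB : B.card ≤ 7) (hu : ∀ w, G.Adj u w → w ∈ B) (hv : ∀ w, G.Adj v w → w ∈ B)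
    (hdu : 5 ≤ G.degree u) (hdu' : G.degree u ≤ 6) : G.degree v ≠ 6 := by
  intro hdv
  have hch := noCherry_of_degree_six hG hdv
  have h₁ := card_neighborFinset_sdiff (G := G) (u := u) (v := v)
  have h₂ := card_sdiff_neighborFinset_le hu hv
  have hvu : ¬ G.Adj v u := fun h => huv h.symm
  rcases Nat.lt_or_ge (G.neighborFinset u \ G.neighborFinset v).card 1 with h₃ | h₃
  · have hT : G.neighborFinset u \ G.neighborFinset v = ∅ := by
      rw [← Finset.card_eq_zero]; omega
    rcases (by omega : G.degree u = 6 ∨ G.degree u = 5) with h₄ | h₄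
    · have hS : G.neighborFinset v \ G.neighborFinset u = ∅ := by
        rw [← Finset.card_eq_zero]; omega
      have hadj := adj_iff_of_sdiff hS hT
      obtain ⟨y, z, hy, hz, hyz⟩ := exists_adj_ne (G := G) (v := v) (by omega)
      obtain ⟨b, c, d, e, g, hnd, hN, hC, -⟩ := exists_cocktail hdv hch hy hz hyz
      refine hG (reducible_of_twins_six (u := u) (nodup_insert_second hne ?_ hnd) hN ?_ hC)
      · rwa [← hN]
      · simpa [← hN] using hadj
    · obtain ⟨y, hS⟩ := Finset.card_eq_one.1
        (by omega : (G.neighborFinset v \ G.neighborFinset u).card = 1)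
      have hadj := adj_iff_of_sdiff hS hT
      have hy : G.Adj v y := by
        have : y ∈ G.neighborFinset v \ G.neighborFinset u := by simp [hS]
        simp at this; exact this.1
      obtain ⟨y₁, y₂, hy₁, hy₂, hyy⟩ := exists_adj_ne (G := G) (v := v) (by omega)
      obtain ⟨z, hz, hyz⟩ : ∃ z, G.Adj v z ∧ y ≠ z := by
        by_cases h : y = y₁
        · exact ⟨y₂, hy₂, h ▸ hyy⟩
        · exact ⟨y₁, hy₁, h⟩
      obtain ⟨b, c, d, e, g, hnd, hN, hC, -⟩ := exists_cocktail hdv hch hy hz hyz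
      refine hG (reducible_of_six_five_sharing_five (u := u)
        (nodup_insert_second hne ?_ hnd) hN ?_ hC)
      · rwa [← hN]
      · intro w
        rw [hadj, hN]
        grind
  · obtain ⟨k, hT⟩ := Finset.card_eq_one.1
      (by omega : (G.neighborFinset u \ G.neighborFinset v).card = 1)
    have hk : G.Adj u k ∧ ¬ G.Adj v k := by
      have : k ∈ G.neighborFinset u \ G.neighborFinset v := by simp [hT]
      simpa using this
    have hku : k ≠ u := hk.1.ne'
    have hkv : k ≠ v := by rintro rfl; exact huv hk.1
    rcases (by omega : G.degree u = 6 ∨ G.degree u = 5) with h₄ | h₄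
    · obtain ⟨y, hS⟩ := Finset.card_eq_one.1
        (by omega : (G.neighborFinset v \ G.neighborFinset u).card = 1)
      have hadj := adj_iff_of_sdiff hS hT
      have hy : G.Adj v y := by
        have : y ∈ G.neighborFinset v \ G.neighborFinset u := by simp [hS]
        simp at this; exact this.1
      obtain ⟨y₁, y₂, hy₁, hy₂, hyy⟩ := exists_adj_ne (G := G) (v := v) (by omega)
      obtain ⟨z, hz, hyz⟩ : ∃ z, G.Adj v z ∧ y ≠ z := by
        by_cases h : y = y₁
        · exact ⟨y₂, hy₂, h ▸ hyy⟩
        · exact ⟨y₁, hy₁, h⟩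
      obtain ⟨b, c, d, e, g, hnd, hN, hC, -⟩ := exists_cocktail hdv hch hy hz hyz
      have hnd' := nodup_insert_second hne (by rwa [← hN]) hnd
      refine hG (reducible_of_six_six_sharing_five (u := u)
        (nodup_concat (h := k) ?_ hnd') hN ?_ hC)
      · rw [hN] at hk
        simp only [List.mem_cons] at hk ⊢
        tauto
      · intro w
        rw [hadj, hN]
        grind
    · obtain ⟨y, z, hyz, hS⟩ := Finset.card_eq_two.1
        (by omega : (G.neighborFinset v \ G.neighborFinset u).card = 2)
      have hadj := adj_iff_of_sdiff hS hT
      have hy : G.Adj v y := by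
        have : y ∈ G.neighborFinset v \ G.neighborFinset u := by simp [hS]
        simp at this; exact this.1
      have hz : G.Adj v z := by
        have : z ∈ G.neighborFinset v \ G.neighborFinset u := by simp [hS]
        simp at this; exact this.1
      obtain ⟨b, c, d, e, g, hnd, hN, hC, hzb⟩ := exists_cocktail hdv hch hy hz hyz
      have hnd' := nodup_insert_second hne (by rwa [← hN]) hnd
      have hnd'' : ([v, u, y, b, c, d, e, g] ++ [k]).Nodup := by
        refine nodup_concat ?_ hnd'
        rw [hN] at hk
        simp only [List.mem_cons] at hk ⊢
        tauto
      rcases hzb with rfl | rfl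
      · refine hG (reducible_of_six_five_missing_pair hnd'' hN (fun w => ?_) hC)
        have := mem_of_nodup_append (l := [y, z]) (List.nodup_cons.1 hnd).2 (w := w)
        rw [hadj, hN, show w ∈ [c, d, e, g, k] ↔ w ∈ [c, d, e, g] ∨ w ∈ [k] from
          List.mem_append (s := [c, d, e, g]), ← this]
        simp
      · refine hG (reducible_of_six_five_missing_edge hnd'' hN (fun w => ?_) hC)
        have := mem_of_nodup_skip (List.nodup_cons.1 hnd).2 (w := w)
        rw [hadj, hN, show w ∈ [b, d, e, g, k] ↔ w ∈ [b, d, e, g] ∨ w ∈ [k] from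
          List.mem_append (s := [b, d, e, g]), ← this]
        simp

end Pairs

section CliquePairs

theorem exists_list_extension [DecidableEq V] {F : Finset V} {s : List V} (hs : s.Nodup)
    (hsF : ∀ x ∈ s, x ∈ F) :
    ∃ r : List V, r.length + s.length = F.card ∧ (s ++ r).Nodup ∧ ∀ w, w ∈ F ↔ w ∈ s ++ r := by
  have hsub : s.toFinset ⊆ F := fun x hx => hsF x (by simpa using hx)
  refine ⟨(F \ s.toFinset).toList, ?_, ?_, ?_⟩
  · rw [Finset.length_toList, ← List.toFinset_card_of_nodup hs,
      Finset.card_sdiff_add_card_eq_card hsub]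
  · refine List.Nodup.append hs (Finset.nodup_toList _) fun x hx hx' => ?_
    simp [hx] at hx'
  · intro w
    by_cases hw : w ∈ s
    · simp [hw, hsF w hw]
    · simp [hw]

variable {G : SimpleGraph V} [Fintype V] [DecidableRel G.Adj] [DecidableEq V]

theorem card_sdiff_of_degree_five (hG : ¬ Reducible G) {u v : V} (hne : u ≠ v)
    (huv : ¬ G.Adj u v) (hu : G.degree u = 5) (hv : G.degree v = 5) :
    2 ≤ (G.neighborFinset u \ G.neighborFinset v).card := by
  by_contra! hlt
  have hgap := atMostOneGap_of_degree_five hG hv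
  have h₁ := card_neighborFinset_sdiff (G := G) (u := u) (v := v)
  have hvu : ¬ G.Adj v u := fun h => huv h.symm
  rcases (by omega : (G.neighborFinset u \ G.neighborFinset v).card = 0 ∨
    (G.neighborFinset u \ G.neighborFinset v).card = 1) with h₂ | h₂
  · have hadj := adj_iff_of_sdiff (Finset.card_eq_zero.1 (by omega)) (Finset.card_eq_zero.1 h₂)
    obtain ⟨y, -, hy, -⟩ := exists_adj_ne (G := G) (v := v) (by omega)
    obtain ⟨a, b, c, d, e, hnd, hN, hC, -⟩ := exists_nearClique hv hgap hy
    refine hG (reducible_of_twins_five (u := u) (nodup_insert_second hne ?_ hnd) hN ?_ hC)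
    · rwa [← hN]
    · simpa [← hN] using hadj
  · obtain ⟨h, hT⟩ := Finset.card_eq_one.1 h₂
    obtain ⟨y, hS⟩ := Finset.card_eq_one.1
      (by omega : (G.neighborFinset v \ G.neighborFinset u).card = 1)
    have hadj := adj_iff_of_sdiff hS hT
    have hh : G.Adj u h ∧ ¬ G.Adj v h := by
      have : h ∈ G.neighborFinset u \ G.neighborFinset v := by simp [hT]
      simpa using this
    have hhu : h ≠ u := hh.1.ne'
    have hhv : h ≠ v := by rintro rfl; exact huv hh.1
    have hy : G.Adj v y := by
      have : y ∈ G.neighborFinset v \ G.neighborFinset u := by simp [hS]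
      simp only [Finset.mem_sdiff, mem_neighborFinset] at this
      exact this.1
    obtain ⟨a, b, c, d, e, hnd, hN, hC, hyac⟩ := exists_nearClique hv hgap hy
    have hnd' := nodup_insert_second hne (by rwa [← hN]) hnd
    have hnd'' : ([v, u, a, b, c, d, e] ++ [h]).Nodup := by
      refine nodup_concat ?_ hnd'
      rw [hN] at hh
      simp only [List.mem_cons] at hh ⊢
      tauto
    rcases hyac with rfl | rfl
    · refine hG (reducible_of_five_five_missing_end hnd'' hN (fun w => ?_) hC)
      rw [hadj, hN]
      grind
    · refine hG (reducible_of_five_five_missing_center hnd'' hN (fun w => ?_) hC)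
      rw [hadj, hN]
      grind

/-- Simultaneous enumeration of two neighbourhoods of order five with three common members. -/
theorem exists_common_list {u v : V} (hne : u ≠ v) (huv : ¬ G.Adj u v) (hu : G.degree u = 5)
    (hv : G.degree v = 5) (h₂ : (G.neighborFinset u \ G.neighborFinset v).card = 2)
    {s t : List V} (hs : s.Nodup) (ht : t.Nodup) (hsu : ∀ x ∈ s, G.Adj v x ∧ G.Adj u x)
    (htv : ∀ x ∈ t, G.Adj v x ∧ ¬ G.Adj u x) :
    ∃ r r' h k, r.length + s.length = 3 ∧ r'.length + t.length = 2 ∧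
      (v :: u :: ((s ++ r) ++ (t ++ r') ++ [h, k])).Nodup ∧
      (∀ w, G.Adj v w ↔ w ∈ (s ++ r) ++ (t ++ r')) ∧ ∀ w, G.Adj u w ↔ w ∈ (s ++ r) ++ [h, k] := by
  have h₁ := card_neighborFinset_sdiff (G := G) (u := u) (v := v)
  have h₃ := Finset.card_sdiff_add_card_inter (G.neighborFinset u) (G.neighborFinset v)
  rw [card_neighborFinset_eq_degree] at h₃
  obtain ⟨r, hr, hrn, hrm⟩ := exists_list_extension
    (F := G.neighborFinset u ∩ G.neighborFinset v) hs
    (fun x hx => by simpa using (hsu x hx).symm)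
  obtain ⟨r', hr', hrn', hrm'⟩ := exists_list_extension
    (F := G.neighborFinset v \ G.neighborFinset u) ht
    (fun x hx => by simpa using htv x hx)
  obtain ⟨h, k, hhk, hT⟩ := Finset.card_eq_two.1 h₂
  have hT' : ∀ w, w ∈ G.neighborFinset u \ G.neighborFinset v ↔ w ∈ [h, k] := by simp [hT]
  simp only [Finset.mem_inter, Finset.mem_sdiff, mem_neighborFinset] at hrm hrm' hT'
  have hvu : ¬ G.Adj v u := fun h => huv h.symm
  refine ⟨r, r', h, k, by omega, by omega, ?_, ?_, ?_⟩
  · have hn : ((s ++ r) ++ (t ++ r') ++ [h, k]).Nodup := by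
      refine List.Nodup.append (List.Nodup.append hrn hrn' ?_) (by simpa using hhk) ?_
      · intro x hx hx'
        exact ((hrm' x).2 hx').2 ((hrm x).2 hx).1
      · intro x hx hx'
        rw [List.mem_append, ← hrm, ← hrm'] at hx
        rw [← hT'] at hx'
        tauto
    refine nodup_insert_second hne ?_ (List.nodup_cons.2 ⟨?_, hn⟩)
    · rw [List.mem_append, List.mem_append, ← hrm, ← hrm', ← hT']
      have := G.irrefl (v := u)
      tauto
    · rw [List.mem_append, List.mem_append, ← hrm, ← hrm', ← hT']
      have := G.irrefl (v := v)
      tauto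
  · intro w
    rw [List.mem_append, ← hrm, ← hrm']
    tauto
  · intro w
    rw [List.mem_append, ← hrm, ← hT']
    tauto

theorem isClique_neighborSet (hG : ¬ Reducible G) {u v : V} (hne : u ≠ v)
    (huv : ¬ G.Adj u v) (hu : G.degree u = 5) (hv : G.degree v = 5)
    (h₂ : (G.neighborFinset u \ G.neighborFinset v).card = 2) :
    ∀ p q, G.Adj v p → G.Adj v q → p ≠ q → G.Adj p q := by
  intro p q hp hq hpq
  by_contra hn
  have hgv := atMostOneGap_of_degree_five hG hv
  have hgu := atMostOneGap_of_degree_five hG hu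
  have key : ∀ x y, G.Adj v x → G.Adj v y → x ≠ y → s(p, q) ≠ s(x, y) → G.Adj x y :=
    fun x y hx hy hxy hne => by
      by_contra hn'
      exact hne (hgv p q x y hp hq hx hy hpq hxy hn hn')
  -- the case of one end of the gap in common
  have cross : ∀ p q, G.Adj v p → G.Adj v q → p ≠ q → ¬ G.Adj p q → G.Adj u p → ¬ G.Adj u q →
      (∀ x y, G.Adj v x → G.Adj v y → x ≠ y → s(p, q) ≠ s(x, y) → G.Adj x y) → False := by
    intro p q hp hq hpq hn hup huq key
    obtain ⟨r, r', h, k, hr, hr', hnd, hNv, hNu⟩ := exists_common_list hne huv hu hv h₂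
      (s := [p]) (t := [q]) (by simp) (by simp) (by simp [*]) (by simp [*])
    obtain ⟨b, c, rfl⟩ := List.length_eq_two.1 (by simpa using hr : r.length = 2)
    obtain ⟨e, rfl⟩ := List.length_eq_one_iff.1 (by simpa using hr' : r'.length = 1)
    refine hG (reducible_of_gap_across hnd hNv hNu hgv hgu hn ?_)
    simp only [List.cons_append, List.nil_append, List.nodup_cons, List.mem_cons, not_or,
      List.not_mem_nil, List.nodup_nil] at hnd hNv
    have h' : ∀ x ∈ [p, b, c, q, e], ∀ y ∈ [p, b, c, q, e], x ≠ y → s(p, q) ≠ s(x, y) →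
        G.Adj x y := fun x hx y hy =>
      key x y ((hNv x).2 (by simpa using hx)) ((hNv y).2 (by simpa using hy))
    simp only [List.forall_mem_cons, ne_eq, Sym2.eq_iff] at h'
    clear key hNu hNv hgv hgu
    grind
  by_cases hup : G.Adj u p <;> by_cases huq : G.Adj u q
  · obtain ⟨r, r', h, k, hr, hr', hnd, hNv, hNu⟩ := exists_common_list hne huv hu hv h₂
      (s := [p, q]) (t := []) (by simpa) (by simp) (by simp [*]) (by simp)
    obtain ⟨c, rfl⟩ := List.length_eq_one_iff.1 (by simpa using hr : r.length = 1)
    obtain ⟨d, e, rfl⟩ := List.length_eq_two.1 (by simpa using hr' : r'.length = 2)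
    refine hG (reducible_of_gap_in_common hnd hNv hNu hgv hgu hn ?_)
    simp only [List.cons_append, List.nil_append, List.nodup_cons, List.mem_cons, not_or,
      List.not_mem_nil, List.nodup_nil] at hnd hNv
    have h' : ∀ x ∈ [p, q, c, d, e], ∀ y ∈ [p, q, c, d, e], x ≠ y → s(p, q) ≠ s(x, y) →
        G.Adj x y := fun x hx y hy =>
      key x y ((hNv x).2 (by simpa using hx)) ((hNv y).2 (by simpa using hy))
    simp only [List.forall_mem_cons, ne_eq, Sym2.eq_iff] at h'
    clear key hNu hNv hgv hgu cross
    grind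
  · exact cross p q hp hq hpq hn hup huq key
  · exact cross q p hq hp hpq.symm (fun h => hn h.symm) huq hup
      (by rwa [Sym2.eq_swap])
  · obtain ⟨r, r', h, k, hr, hr', hnd, hNv, hNu⟩ := exists_common_list hne huv hu hv h₂
      (s := []) (t := [p, q]) (by simp) (by simpa) (by simp) (by simp [*])
    obtain ⟨a, b, c, rfl⟩ := List.length_eq_three.1 (by simpa using hr : r.length = 3)
    obtain rfl := List.length_eq_zero_iff.1 (by simpa using hr' : r'.length = 0)
    refine hG (reducible_of_gap_private hnd hNv hNu hgv hgu hn ?_)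
    simp only [List.cons_append, List.nil_append, List.nodup_cons, List.mem_cons, not_or,
      List.not_mem_nil, List.nodup_nil, List.append_nil] at hnd hNv
    have h' : ∀ x ∈ [a, b, c, p, q], ∀ y ∈ [a, b, c, p, q], x ≠ y → s(p, q) ≠ s(x, y) →
        G.Adj x y := fun x hx y hy =>
      key x y ((hNv x).2 (by simpa using hx)) ((hNv y).2 (by simpa using hy))
    simp only [List.forall_mem_cons, ne_eq, Sym2.eq_iff] at h'
    clear key hNu hNv hgv hgu cross
    grind

/-- Two non-adjacent vertices whose neighbourhoods lie in a common set of size seven both have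
degree five, and share exactly three neighbours. -/
theorem degree_eq_five_of_pair (hG : ¬ Reducible G) {u v : V} (hne : u ≠ v) (huv : ¬ G.Adj u v)
    {B : Finset V} (hB : B.card ≤ 7) (hu : ∀ w, G.Adj u w → w ∈ B) (hv : ∀ w, G.Adj v w → w ∈ B)
    (hu₀ : 0 < G.degree u) (hv₀ : 0 < G.degree v) (hu₆ : G.degree u ≤ 6) (hv₆ : G.degree v ≤ 6) :
    G.degree u = 5 ∧ G.degree v = 5 ∧ (G.neighborFinset u \ G.neighborFinset v).card = 2 := by
  have hu₅ := five_le_degree hG hu₀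
  have hv₅ := five_le_degree hG hv₀
  have h₁ := degree_ne_six hG hne huv hB hu hv hu₅ hu₆
  have h₂ := degree_ne_six hG hne.symm (fun h => huv h.symm) hB hv hu hv₅ hv₆
  have hu' : G.degree u = 5 := by omega
  have hv' : G.degree v = 5 := by omega
  have h₃ := card_sdiff_of_degree_five hG hne huv hu' hv'
  have h₄ := card_sdiff_neighborFinset_le hu hv
  exact ⟨hu', hv', by omega⟩

end CliquePairs

section Apex

variable {G : SimpleGraph V} [Fintype V] [DecidableRel G.Adj] [DecidableEq V]

/-- The neighbours of `x` outside the closed neighbourhood of `v`, as a list. -/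
theorem exists_outer_list {v x : V} {l : List V} (hnd : (v :: l).Nodup)
    (hN : ∀ w, G.Adj v w ↔ w ∈ l) :
    ∃ r : List V, r.length = (G.neighborFinset x \ insert v (G.neighborFinset v)).card ∧
      (v :: (l ++ r)).Nodup ∧ (∀ w, G.Adj x w → w ∈ v :: (l ++ r)) ∧ ∀ w ∈ r, G.Adj x w := by
  have hr : ∀ w, w ∈ (G.neighborFinset x \ insert v (G.neighborFinset v)).toList ↔
      G.Adj x w ∧ w ≠ v ∧ w ∉ l := by
    intro w
    simp [hN]
  refine ⟨_, Finset.length_toList _, ?_, fun w hw => ?_, fun w hw => ((hr w).1 hw).1⟩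
  · rw [← List.cons_append]
    refine List.Nodup.append hnd (Finset.nodup_toList _) fun w hw hw' => ?_
    rw [hr] at hw'
    simp only [List.mem_cons] at hw
    tauto
  · rw [List.mem_cons, List.mem_append, hr]
    tauto

theorem card_outer_of_degree_six (hG : ¬ Reducible G) {v x : V} (hvx : G.Adj v x)
    (hv : G.degree v = 6) : 2 ≤ (G.neighborFinset x \ insert v (G.neighborFinset v)).card := by
  by_contra! hlt
  obtain ⟨z, hz, hxz⟩ : ∃ z, G.Adj v z ∧ x ≠ z := by
    obtain ⟨y₁, y₂, h₁, h₂, hyy⟩ := exists_adj_ne (G := G) (v := v) (by omega)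
    by_cases h : x = y₁
    · exact ⟨y₂, h₂, h ▸ hyy⟩
    · exact ⟨y₁, h₁, h⟩
  obtain ⟨b, c, d, e, g, hnd, hN, hC, -⟩ :=
    exists_cocktail hv (noCherry_of_degree_six hG hv) hvx hz hxz
  obtain ⟨r, hr, hrn, hrx, hra⟩ := exists_outer_list (x := x) hnd hN
  rw [← hr] at hlt
  match r, hlt, hrn, hrx, hra with
  | [], _, hrn, hrx, _ => exact hG (reducible_of_leaf_six hrn hN hrx hC)
  | [h], _, hrn, hrx, hra =>
    exact hG (reducible_of_leaf_six_extra hrn hN hrx (hra h (by simp)) hC)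

theorem card_outer_of_degree_five (hG : ¬ Reducible G) {v x : V} (hvx : G.Adj v x)
    (hv : G.degree v = 5) : 3 ≤ (G.neighborFinset x \ insert v (G.neighborFinset v)).card := by
  by_contra! hlt
  obtain ⟨a, b, c, d, e, hnd, hN, hC, rfl | rfl⟩ :=
    exists_nearClique hv (atMostOneGap_of_degree_five hG hv) hvx
  · obtain ⟨r, hr, hrn, hrx, hra⟩ := exists_outer_list (x := x) hnd hN
    rw [← hr] at hlt
    match r, hlt, hrn, hrx, hra with
    | [], _, hrn, hrx, _ => exact hG (reducible_of_leaf_five_end hrn hN hrx hC)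
    | [h], _, hrn, hrx, hra =>
      exact hG (reducible_of_leaf_five_end_extra hrn hN hrx (hra h (by simp)) hC)
    | [h, k], _, hrn, hrx, hra =>
      exact hG (reducible_of_leaf_five_end_two_extra hrn hN hrx (hra h (by simp))
        (hra k (by simp)) hC)
  · have hp : [a, b, x, d, e].Perm [x, a, b, d, e] := List.perm_middle (l₁ := [a, b])
    have hN' : ∀ w, G.Adj v w ↔ w ∈ [x, a, b, d, e] := fun w => (hN w).trans hp.mem_iff
    obtain ⟨r, hr, hrn, hrx, hra⟩ := exists_outer_list (x := x) ((hp.cons v).nodup hnd) hN'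
    rw [← hr] at hlt
    match r, hlt, hrn, hrx, hra with
    | [], _, hrn, hrx, _ => exact hG (reducible_of_leaf_five_center hrn hN' hrx hC)
    | [h], _, hrn, hrx, hra =>
      exact hG (reducible_of_leaf_five_center_extra hrn hN' hrx (hra h (by simp)) hC)
    | [h, k], _, hrn, hrx, hra =>
      exact hG (reducible_of_leaf_five_center_two_extra hrn hN' hrx (hra h (by simp))
        (hra k (by simp)) hC)

/-- A third vertex of degree five sharing three neighbours with each of `v` and `u`. -/
theorem adj_iff_of_third {v u z x b c d e h k : V} (hnd : [x, d, e, h, k].Nodup)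
    (hNv : ∀ w, G.Adj v w ↔ w ∈ [x, b, c, d, e]) (hNu : ∀ w, G.Adj u w ↔ w ∈ [x, b, c, h, k])
    (hzB : ∀ w, G.Adj z w → w ∈ [x, b, c, d, e, h, k]) (hz₅ : G.degree z = 5) (hzx : G.Adj z x)
    (hzv₂ : (G.neighborFinset z \ G.neighborFinset v).card = 2)
    (hzu₂ : (G.neighborFinset z \ G.neighborFinset u).card = 2) (w : V) :
    G.Adj z w ↔ w ∈ [x, d, e, h, k] := by
  have hzhk : G.neighborFinset z \ G.neighborFinset v = {h, k} := by
    refine Finset.eq_of_subset_of_card_le (fun w hw => ?_) ?_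
    · simp only [Finset.mem_sdiff, mem_neighborFinset, hNv] at hw
      have := hzB w hw.1
      simp only [List.mem_cons, Finset.mem_insert, Finset.mem_singleton] at this hw ⊢
      tauto
    · exact Finset.card_le_two.trans hzv₂.ge
  have hzde : G.neighborFinset z \ G.neighborFinset u = {d, e} := by
    refine Finset.eq_of_subset_of_card_le (fun w hw => ?_) ?_
    · simp only [Finset.mem_sdiff, mem_neighborFinset, hNu] at hw
      have := hzB w hw.1
      simp only [List.mem_cons, Finset.mem_insert, Finset.mem_singleton] at this hw ⊢
      tauto
    · exact Finset.card_le_two.trans hzu₂.ge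
  have hsub : ∀ w ∈ [x, d, e, h, k], G.Adj z w := by
    have h₃ : ∀ w ∈ ({h, k} : Finset V), G.Adj z w := fun w hw => by
      rw [← hzhk] at hw
      simp only [Finset.mem_sdiff, mem_neighborFinset] at hw
      exact hw.1
    have h₄ : ∀ w ∈ ({d, e} : Finset V), G.Adj z w := fun w hw => by
      rw [← hzde] at hw
      simp only [Finset.mem_sdiff, mem_neighborFinset] at hw
      exact hw.1
    simp only [Finset.mem_insert, Finset.mem_singleton, forall_eq_or_imp, forall_eq] at h₃ h₄
    simp [h₃, h₄, hzx]
  have heq : [x, d, e, h, k].toFinset = G.neighborFinset z := by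
    refine Finset.eq_of_subset_of_card_le (fun w hw => ?_) ?_
    · rw [List.mem_toFinset] at hw
      simpa using hsub w hw
    · rw [card_neighborFinset_eq_degree, hz₅, List.toFinset_card_of_nodup hnd]
      rfl
  rw [← mem_neighborFinset, ← heq, List.mem_toFinset]

/-- A vertex `x` together with a nonempty set `L` of leaves, all of whose neighbours lie in a set
of six vertices apart from the adjacencies between `x` and `L`, admits a reduction. -/
theorem reducible_of_apex {x : V} {W L : Finset V} (hW : W.card ≤ 6)
    (hx : ∀ w, G.Adj x w → w ∈ W ∨ w ∈ L) (hL : ∀ u ∈ L, ∀ w, G.Adj u w → w ∈ W ∨ w = x)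
    (hxL : x ∉ L) (hLW : Disjoint L W) (hne : L.Nonempty)
    (hL₀ : ∀ u ∈ L, 0 < G.degree u) (hL₆ : ∀ u ∈ L, G.degree u ≤ 6) (hx₀ : 0 < G.degree x) :
    Reducible G := by
  by_contra hG
  have hxv : ∃ v ∈ L, G.Adj x v := by
    by_contra! hno
    obtain ⟨v, hv⟩ := hne
    have hxW : ∀ w, G.Adj x w → w ∈ W := fun w hw => (hx w hw).resolve_right fun h => hno w h hw
    have hvW : ∀ w, G.Adj v w → w ∈ W := fun w hw => (hL v hv w hw).resolve_right fun h =>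
      hno v hv (h ▸ hw).symm
    have hx₆ : G.degree x ≤ 6 := by
      rw [← card_neighborFinset_eq_degree]
      exact (Finset.card_le_card fun w hw => hxW w (by simpa using hw)).trans hW
    have hxv : x ≠ v := by rintro rfl; exact hxL hv
    obtain ⟨-, h₁, h₂⟩ := degree_eq_five_of_pair hG hxv (hno v hv) (by omega) hxW hvW hx₀
      (hL₀ v hv) hx₆ (hL₆ v hv)
    have := card_sdiff_neighborFinset_le hxW hvW
    omega
  obtain ⟨v, hv, hxv⟩ := hxv
  have hLB : ∀ u ∈ L, ∀ w, G.Adj u w → w ∈ insert x W := fun u hu w hw => by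
    rw [Finset.mem_insert]
    exact (hL u hu w hw).symm
  have hB : (insert x W).card ≤ 7 := (Finset.card_insert_le x W).trans (by omega)
  have hLL : ∀ u ∈ L, ∀ w ∈ L, ¬ G.Adj u w := by
    intro u hu w hw h
    rcases hL u hu w h with h | rfl
    · exact Finset.disjoint_left.1 hLW hw h
    · exact hxL hw
  have pair : ∀ u ∈ L, ∀ w ∈ L, u ≠ w → G.degree u = 5 ∧ G.degree w = 5 ∧
      (G.neighborFinset u \ G.neighborFinset w).card = 2 := fun u hu w hw huw =>
    degree_eq_five_of_pair hG huw (hLL u hu w hw) hB (hLB u hu) (hLB w hw) (hL₀ u hu) (hL₀ w hw)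
      (hL₆ u hu) (hL₆ w hw)
  have clique : ∀ u ∈ L, ∀ w ∈ L, u ≠ w → ∀ p q, G.Adj w p → G.Adj w q → p ≠ q → G.Adj p q :=
    fun u hu w hw huw => by
      obtain ⟨h₁, h₂, h₃⟩ := pair u hu w hw huw
      exact isClique_neighborSet hG huw (hLL u hu w hw) h₁ h₂ h₃
  have hxu : ∃ u ∈ L, u ≠ v ∧ G.Adj x u := by
    by_contra! hno
    have hcard : (G.neighborFinset x \ insert v (G.neighborFinset v)).card + G.degree v ≤ 7 := by
      rw [← card_neighborFinset_eq_degree, ← Finset.card_union_of_disjoint]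
      · refine (Finset.card_le_card fun w hw => ?_).trans hB
        simp only [Finset.mem_union, Finset.mem_sdiff, mem_neighborFinset, Finset.mem_insert,
          not_or] at hw
        rcases hw with ⟨h₁, h₂, -⟩ | h
        · exact Finset.mem_insert_of_mem ((hx w h₁).resolve_right fun h => hno w h h₂ h₁)
        · exact hLB v hv w h
      · exact Finset.disjoint_left.2 fun w hw hw' => by simp_all
    have h₅ := five_le_degree hG (hL₀ v hv)
    rcases (by have := hL₆ v hv; omega : G.degree v = 5 ∨ G.degree v = 6) with h | h
    · have := card_outer_of_degree_five hG hxv.symm h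
      omega
    · have := card_outer_of_degree_six hG hxv.symm h
      omega
  obtain ⟨u, hu, huv, hxu⟩ := hxu
  obtain ⟨hu₅, hv₅, h₂⟩ := pair u hu v hv huv
  have hcv := clique u hu v hv huv
  have hcu := clique v hv u hu huv.symm
  obtain ⟨r, r', h, k, hr, hr', hnd, hNv, hNu⟩ := exists_common_list huv (hLL u hu v hv) hu₅ hv₅ h₂
    (s := [x]) (t := []) (by simp) (by simp) (by simp [hxu.symm, hxv.symm]) (by simp)
  obtain ⟨b, c, rfl⟩ := List.length_eq_two.1 (by simpa using hr : r.length = 2)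
  obtain ⟨d, e, rfl⟩ := List.length_eq_two.1 (by simpa using hr' : r'.length = 2)
  simp only [List.cons_append, List.nil_append] at hnd hNv hNu
  have hBeq : [x, b, c, d, e, h, k].toFinset = insert x W := by
    refine Finset.eq_of_subset_of_card_le (fun w hw => ?_) ?_
    · by_cases h' : w ∈ [x, b, c, d, e]
      · exact hLB v hv w ((hNv w).2 h')
      · refine hLB u hu w ((hNu w).2 ?_)
        simp only [List.mem_toFinset, List.mem_cons] at hw h' ⊢
        tauto
    · rw [List.toFinset_card_of_nodup (List.nodup_cons.1 (List.nodup_cons.1 hnd).2).2]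
      simpa using hB
  have hvc : ∀ p ∈ [x, b, c, d, e], ∀ q ∈ [x, b, c, d, e], p ≠ q → G.Adj p q :=
    fun p hp q hq => hcv p q ((hNv p).2 hp) ((hNv q).2 hq)
  have huc : ∀ p ∈ [x, b, c, h, k], ∀ q ∈ [x, b, c, h, k], p ≠ q → G.Adj p q :=
    fun p hp q hq => hcu p q ((hNu p).2 hp) ((hNu q).2 hq)
  by_cases hz : ∃ z ∈ L, z ≠ v ∧ z ≠ u ∧ G.Adj x z
  · obtain ⟨z, hz, hzv, hzu, hxz⟩ := hz
    obtain ⟨hz₅, -, hzv₂⟩ := pair z hz v hv hzv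
    obtain ⟨-, -, hzu₂⟩ := pair z hz u hu hzu
    have hzW : z ∉ insert x W := by
      rw [Finset.mem_insert, not_or]
      exact ⟨hxz.ne', Finset.disjoint_left.1 hLW hz⟩
    have hzB : ∀ w, G.Adj z w → w ∈ [x, b, c, d, e, h, k] := fun w hw => by
      rw [← List.mem_toFinset, hBeq]
      exact hLB z hz w hw
    have hNz := adj_iff_of_third (List.Sublist.nodup
      (.cons _ (.cons _ (.cons_cons _ (.cons _ (.cons _ (.refl _)))))) hnd) hNv hNu hzB hz₅
      hxz.symm hzv₂ hzu₂
    have hcz := clique v hv z hz hzv.symm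
    refine hG (reducible_of_three_leaves ?_ hNv hNu hNz hvc huc
      fun p hp q hq => hcz p q ((hNz p).2 hp) ((hNz q).2 hq))
    refine nodup_concat (l := [v, u, x, b, c, d, e, h, k]) ?_ hnd
    rw [← hBeq] at hzW
    rw [List.mem_cons, List.mem_cons, not_or, not_or]
    exact ⟨hzv, hzu, by simpa only [List.mem_toFinset] using hzW⟩
  · push Not at hz
    refine hG (reducible_of_two_leaves hnd hNv hNu (fun w hw => ?_) hvc huc)
    have : w = v ∨ w = u ∨ w ∈ W := by
      rcases hx w hw with h' | h'
      · exact .inr (.inr h')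
      · by_contra! hcon
        exact hz w h' hcon.1 hcon.2.1 hw
    rcases this with rfl | rfl | h'
    · simp
    · simp
    · have h'' := Finset.mem_insert_of_mem (b := x) h'
      rw [← hBeq, List.mem_toFinset, List.mem_cons] at h''
      exact List.mem_cons_of_mem _ (List.mem_cons_of_mem _ (h''.resolve_left hw.ne'))

end Apex

section Elimination

/-- In a connected graph, a path from `r` that enters the connected set `S` at a point `m` closest
to `r` can be continued inside `S` to any point of `S`. -/
theorem exists_path_through_nearest {α : Type*} {T : SimpleGraph α} (hT : T.Connected)
    {S : Set α} (hS : (T.induce S).Connected) {r m t : α} (hm : m ∈ S) (ht : t ∈ S)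
    (hmin : ∀ s ∈ S, T.dist r m ≤ T.dist r s) :
    ∃ Q : T.Walk r t, Q.IsPath ∧ Q.getVert (T.dist r m) = m ∧
      ∀ i, T.dist r m ≤ i → Q.getVert i ∈ S := by
  obtain ⟨g, hg, hlen⟩ := hT.exists_path_of_dist r m
  obtain ⟨q, hq⟩ := hS.exists_isPath ⟨m, hm⟩ ⟨t, ht⟩
  let q' : T.Walk m t := q.map (Embedding.induce S).toHom
  have hq' : q'.IsPath := hq.map (Embedding.induce (G := T) S).injective
  have hqS : ∀ x ∈ q'.support, x ∈ S := by
    intro x hx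
    rw [show q'.support = _ from Walk.support_map _ _, List.mem_map] at hx
    obtain ⟨y, -, rfl⟩ := hx
    exact y.2
  have hgS : ∀ x ∈ g.support, x ∈ S → x = m := by
    intro x hx hxS
    obtain ⟨i, rfl, hi⟩ := Walk.mem_support_iff_exists_getVert.1 hx
    have h₁ : T.dist r (g.getVert i) ≤ i :=
      (dist_le (g.take i)).trans (by simp)
    have h₂ := hmin _ hxS
    rw [show i = g.length by omega, Walk.getVert_length]
  refine ⟨g.append q', ?_, ?_, fun i hi => ?_⟩
  · rw [Walk.isPath_def, Walk.support_append]
    refine List.Nodup.append hg.support_nodup hq'.support_nodup.tail fun x hx hx' => ?_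
    obtain rfl := hgS x hx (hqS x (List.mem_of_mem_tail hx'))
    have := hq'.support_nodup
    rw [← Walk.cons_tail_support, List.nodup_cons] at this
    exact this.1 hx'
  · rw [Walk.getVert_append, hlen]
    simp
  · rw [Walk.getVert_append, if_neg (by omega)]
    exact hqS _ (Walk.getVert_mem_support _ _)

/-- In a tree, of two intersecting subtrees the one starting closer to the root contains the
starting point of the other. -/
theorem mem_of_dist_le {α : Type*} {T : SimpleGraph α} (hT : T.IsTree) {S S' : Set α}
    (hS : (T.induce S).Connected) (hS' : (T.induce S').Connected) {r m m' t : α}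
    (hm : m ∈ S) (hm' : m' ∈ S') (ht : t ∈ S) (ht' : t ∈ S')
    (hmin : ∀ s ∈ S, T.dist r m ≤ T.dist r s) (hmin' : ∀ s ∈ S', T.dist r m' ≤ T.dist r s)
    (hle : T.dist r m ≤ T.dist r m') : m' ∈ S := by
  obtain ⟨Q, hQ, -, hQS⟩ := exists_path_through_nearest hT.connected hS hm ht hmin
  obtain ⟨Q', hQ', hQm', -⟩ := exists_path_through_nearest hT.connected hS' hm' ht' hmin'
  have heq : Q = Q' :=
    congrArg Subtype.val ((hT.isAcyclic.subsingleton_path r t).elim ⟨Q, hQ⟩ ⟨Q', hQ'⟩)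
  rw [← hQm', ← heq]
  exact hQS _ hle

/-- A tree decomposition of width at most `k` yields an ordering of the vertices in which each
vertex `v` has a set `A v` of at most `k` predecessors containing all its earlier neighbours, and
the sets are nested as in a chordal completion. -/
theorem exists_elimination_order [Fintype V] {G : SimpleGraph V} {k : ℕ}
    (h : HasDecompOfWidthLE G k) :
    ∃ (rank : V → ℕ) (A : V → Finset V), rank.Injective ∧ (∀ v, (A v).card ≤ k) ∧
      (∀ u v, u ∈ A v → rank u < rank v) ∧
      (∀ u v, G.Adj u v → rank u < rank v → u ∈ A v) ∧
      ∀ u w v, u ∈ A v → w ∈ A v → rank u < rank w → u ∈ A w := by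
  classical
  obtain ⟨α, D, hD⟩ := h
  obtain ⟨r⟩ := D.isTree.connected.nonempty
  have hp : ∀ v, ∃ m, v ∈ D.bag m ∧ ∀ s, v ∈ D.bag s → D.T.dist r m ≤ D.T.dist r s := by
    intro v
    have hne : ({t | v ∈ D.bag t} : Set α).Nonempty := D.covers v
    exact ⟨_, Function.argminOn_mem (D.T.dist r) _ hne, fun s hs =>
      Function.argminOn_le (D.T.dist r) {t | v ∈ D.bag t} hs⟩
  choose p hpv hpmin using hp
  let idx := Fintype.equivFin V
  let rank : V → ℕ := fun v => D.T.dist r (p v) * Fintype.card V + idx v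
  have hdepth : ∀ u v, rank u < rank v → D.T.dist r (p u) ≤ D.T.dist r (p v) := by
    intro u v huv
    by_contra! hlt
    have h₁ : (D.T.dist r (p v) + 1) * Fintype.card V ≤ D.T.dist r (p u) * Fintype.card V :=
      Nat.mul_le_mul_right _ hlt
    have h₂ := (idx v).isLt
    simp only [rank] at huv
    rw [Nat.add_mul] at h₁
    omega
  have hinj : rank.Injective := by
    intro u v huv
    have h₁ := congrArg (· % Fintype.card V) huv
    simp only [rank, Nat.add_mod, Nat.mul_mod_left, zero_add,
      Nat.mod_eq_of_lt (idx _).isLt] at h₁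
    exact idx.injective (Fin.ext h₁)
  have key : ∀ u w t, u ∈ D.bag t → w ∈ D.bag t → rank u < rank w → u ∈ D.bag (p w) :=
    fun u w t hu hw hlt => mem_of_dist_le (S := {t | u ∈ D.bag t}) (S' := {t | w ∈ D.bag t})
      D.isTree (D.subtree u) (D.subtree w) (hpv u) (hpv w) hu hw (hpmin u) (hpmin w)
      (hdepth u w hlt)
  refine ⟨rank, fun v => {u ∈ D.bag (p v) | rank u < rank v}, hinj, fun v => ?_, ?_, ?_, ?_⟩
  · have h₁ : ({u ∈ D.bag (p v) | rank u < rank v} : Finset V) ⊆ (D.bag (p v)).erase v := by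
      intro u hu
      simp only [Finset.mem_filter] at hu
      exact Finset.mem_erase.2 ⟨fun h => hu.2.ne (h ▸ rfl), hu.1⟩
    have h₂ := Finset.card_le_card h₁
    rw [Finset.card_erase_of_mem (hpv v)] at h₂
    exact h₂.trans (Nat.sub_le_iff_le_add.2 (hD (p v)))
  · intro u v hu
    exact (Finset.mem_filter.1 hu).2
  · intro u v huv hlt
    obtain ⟨t, hu, hv⟩ := D.edge_mem huv
    exact Finset.mem_filter.2 ⟨key u v t hu hv hlt, hlt⟩
  · intro u w v hu hw hlt
    simp only [Finset.mem_filter] at hu hw ⊢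
    exact ⟨key u w (p v) hu.1 hw.1 hlt, hlt⟩

end Elimination

section Tuza

/-- A graph with an edge and an elimination order of width at most six admits a reduction. -/
theorem reducible_of_elimination_order [Fintype V] {G : SimpleGraph V} (hG : G ≠ ⊥) {rank : V → ℕ}
    {A : V → Finset V} (hinj : rank.Injective) (hcard : ∀ v, (A v).card ≤ 6)
    (hlt : ∀ u v, u ∈ A v → rank u < rank v)
    (hadj : ∀ u v, G.Adj u v → rank u < rank v → u ∈ A v)
    (hnest : ∀ u w v, u ∈ A v → w ∈ A v → rank u < rank w → u ∈ A w) : Reducible G := by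
  classical
  have hpos : ∀ {u v}, G.Adj u v → 0 < G.degree u := fun {u v} h =>
    (G.degree_pos_iff_exists_adj u).2 ⟨v, h⟩
  let P : Finset V := {x | 0 < G.degree x ∧ ∃ v, 0 < G.degree v ∧ x ∈ A v ∧
    ∀ y ∈ A v, 0 < G.degree y → rank y ≤ rank x}
  have hmax : ∀ v, 0 < G.degree v → ∀ y ∈ A v, 0 < G.degree y → ∃ x ∈ P, rank y ≤ rank x := by
    intro v hv y hy hy₀
    obtain ⟨x, hx, hxmax⟩ := Finset.exists_max_image {z ∈ A v | 0 < G.degree z} rank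
      ⟨y, by simp [hy, hy₀]⟩
    simp only [Finset.mem_filter, and_imp] at hx hxmax
    refine ⟨x, ?_, hxmax y hy hy₀⟩
    simp only [P, Finset.mem_filter_univ]
    exact ⟨hx.2, v, hv, hx.1, hxmax⟩
  have hP : P.Nonempty := by
    obtain ⟨u, v, huv⟩ := ne_bot_iff_exists_adj.1 hG
    rcases (hinj.ne huv.ne).lt_or_gt with h | h
    · obtain ⟨x, hx, -⟩ := hmax v (hpos huv.symm) u (hadj u v huv h) (hpos huv)
      exact ⟨x, hx⟩
    · obtain ⟨x, hx, -⟩ := hmax u (hpos huv) v (hadj v u huv.symm h) (hpos huv.symm)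
      exact ⟨x, hx⟩
  obtain ⟨x, hxP, hxmax⟩ := Finset.exists_max_image P rank hP
  simp only [P, Finset.mem_filter_univ] at hxP
  obtain ⟨hx₀, v, hv₀, hxv, -⟩ := hxP
  have hbelow : ∀ u, 0 < G.degree u → ∀ y ∈ A u, 0 < G.degree y → rank y ≤ rank x := by
    intro u hu y hy hy₀
    obtain ⟨z, hz, hyz⟩ := hmax u hu y hy hy₀
    exact hyz.trans (hxmax z hz)
  have hleaf : ∀ u, x ∈ A u → ∀ w, G.Adj u w → w ∈ A u := by
    intro u hu w huw
    refine hadj w u huw.symm ?_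
    by_contra! hle
    have := hbelow w (hpos huw.symm) u (hadj u w huw (hle.lt_of_ne (hinj.ne huw.ne))) (hpos huw)
    exact absurd (hlt x u hu) this.not_gt
  refine reducible_of_apex (x := x) (W := A x) (L := {u | 0 < G.degree u ∧ x ∈ A u}) (hcard x)
    (fun w hw => ?_) ?_ ?_ ?_ ⟨v, by simp [hv₀, hxv]⟩ ?_ ?_ hx₀
  · rcases (hinj.ne hw.ne).lt_or_gt with h | h
    · right
      simp only [Finset.mem_filter_univ]
      exact ⟨hpos hw.symm, hadj x w hw h⟩
    · exact .inl (hadj w x hw.symm h)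
  · intro u hu w huw
    simp only [Finset.mem_filter_univ] at hu
    have hwu := hleaf u hu.2 w huw
    rcases (hbelow u hu.1 w hwu (hpos huw.symm)).lt_or_eq with h | h
    · exact .inl (hnest w x u hwu hu.2 h)
    · exact .inr (hinj h)
  · simp only [Finset.mem_filter_univ, not_and]
    exact fun _ h => (hlt x x h).false
  · refine Finset.disjoint_left.2 fun u hu hux => ?_
    simp only [Finset.mem_filter_univ] at hu
    exact (hlt x u hu.2).asymm (hlt u x hux)
  · intro u hu
    simp only [Finset.mem_filter_univ] at hu
    exact hu.1
  · intro u hu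
    simp only [Finset.mem_filter_univ] at hu
    rw [← card_neighborFinset_eq_degree]
    exact (Finset.card_le_card fun w hw => hleaf u hu.2 w (by simpa using hw)).trans (hcard u)

theorem tuzaBound_bot : TuzaBound (⊥ : SimpleGraph V) := by
  refine ⟨∅, ∅, ⟨by simp, fun t ht => ?_⟩, ⟨by simp, by simp⟩, by simp⟩
  obtain ⟨e, he, -⟩ := exists_edge_of_isNClique ht
  simp at he

/-- Tuza's inequality for graphs with a tree decomposition of width at most six. -/
theorem tuzaBound_of_hasDecomp [Fintype V] {G : SimpleGraph V} (h : HasDecompOfWidthLE G 6) :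
    TuzaBound G := by
  obtain ⟨rank, A, hinj, hcard, hlt, hadj, hnest⟩ := exists_elimination_order h
  suffices ∀ H : SimpleGraph V, H ≤ G → TuzaBound H from this G le_rfl
  intro H
  induction H using WellFoundedLT.induction with
  | ind H ih =>
    intro hH
    by_cases hbot : H = ⊥
    · exact hbot ▸ tuzaBound_bot
    · exact (reducible_of_elimination_order hbot hinj hcard hlt
        (fun u v huv => hadj u v (hH huv)) hnest).tuzaBound fun K hK => ih K hK (hK.le.trans hH)

theorem HasDecompOfWidthLE.mono {G : SimpleGraph V} {k l : ℕ} (hkl : k ≤ l)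
    (h : HasDecompOfWidthLE G k) : HasDecompOfWidthLE G l := by
  obtain ⟨α, D, hD⟩ := h
  exact ⟨α, D, fun t => (hD t).trans (by omega)⟩

/-- Every finite graph has a tree decomposition with a single bag. -/
theorem hasDecompOfWidthLE_card [Fintype V] (G : SimpleGraph V) :
    HasDecompOfWidthLE G (Fintype.card V) := by
  refine ⟨Unit, ⟨⊥, .of_subsingleton, fun _ => Finset.univ, by simp, by simp, fun v => ?_⟩,
    fun _ => (Finset.card_le_univ _).trans (Nat.le_succ _)⟩
  have : Nonempty {t : Unit | v ∈ (Finset.univ : Finset V)} := ⟨⟨(), by simp⟩⟩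
  exact ⟨.of_subsingleton⟩

theorem hasDecompOfWidthLE_treewidth [Fintype V] (G : SimpleGraph V) :
    HasDecompOfWidthLE G (treewidth G) :=
  Nat.sInf_mem (s := {k | HasDecompOfWidthLE G k}) ⟨_, hasDecompOfWidthLE_card G⟩

end Tuza

end TriangleReduction

/-- A minimum-order graph of treewidth at most `6` with `τ > 2·ν` is robust: for every
vertex `v`, each connected component of the subgraph induced on `N(v)` has at least `5`
vertices. -/
theorem minimal_counterexample_robust (V : Type) [Fintype V] (G : SimpleGraph V)
    (htw : treewidth G ≤ 6) (hcex : 2 * nu G < tau G)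
    (hmin : ∀ (W : Type) [Fintype W] (H : SimpleGraph W),
      treewidth H ≤ 6 → 2 * nu H < tau H → Fintype.card V ≤ Fintype.card W) :
    Robust G := by
  exfalso
  have h := TriangleReduction.HasDecompOfWidthLE.mono htw
    (TriangleReduction.hasDecompOfWidthLE_treewidth G)
  exact hcex.not_ge (TriangleReduction.tuzaBound_of_hasDecomp h).tau_le
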